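/- For each n, let b^{(n)} = (b_k^{(n)},…,b_2^{(n)},b_1^{(n)}) be any composition of n such that the layered permutation w(b^{(n)}) attains the maximum v(n) = max_{w ∈ 𝓛_n} Υ_w. Then for every fixed i ≥ 1, we have b_i^{(n)}/n → (1−α)·α^{i−1} as n → ∞, where α is the unique solution in (0,1) of 2x·f(x) + (1−x²)·f′(x) = 0. (Here b_1 is the last layer, i.e. the block of the layered permutation containing n.) -/

import Mathlib

/-- The simple transposition `sᵢ = (i, i+1)` acting on `ℕ` (positions are 1-indexed,
so a permutation of `{1,…,n}` is modeled as a permutation of `ℕ` fixing `0` and all `i > n`). -/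
def sT (i : ℕ) : Equiv.Perm ℕ := Equiv.swap i (i + 1)

/-- The number of inversions `ℓ(w)` of `w` on `{1,…,n}`. -/
def len (n : ℕ) (w : Equiv.Perm ℕ) : ℕ :=
  ((Finset.Icc 1 n ×ˢ Finset.Icc 1 n).filter
    (fun p => p.1 < p.2 ∧ w p.2 < w p.1)).card

open scoped Classical in
/-- Macdonald's identity form of the principal specialization `𝔖_w(1,…,1)` of the
Schubert polynomial: `Υ_w = (1/ℓ!) ⬝ Σ_{(a₁,…,a_ℓ) ∈ R(w)} a₁ a₂ ⋯ a_ℓ`, where the sum is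
over reduced words of `w`, i.e. tuples with `1 ≤ aᵢ ≤ n − 1` and `w = s_{a₁} ⋯ s_{a_ℓ}`. -/
noncomputable def Upsilon (n : ℕ) (w : Equiv.Perm ℕ) : ℚ :=
  ((len n w).factorial : ℚ)⁻¹ *
    ∑ a ∈ Finset.univ.filter (fun a : Fin (len n w) → Fin n =>
        (∀ i, 1 ≤ (a i : ℕ)) ∧ (List.ofFn fun i => sT ((a i : ℕ))).prod = w),
      ∏ i, ((a i : ℕ) : ℚ)

/-- Reversal of the block of positions `s+1, …, s+c`, as a permutation of `ℕ`. -/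
def blockRev (s c : ℕ) : Equiv.Perm ℕ :=
  ((List.range (c / 2)).map fun i => Equiv.swap (s + i + 1) (s + c - i)).prod

/-- The layered permutation `w(b_k, …, b_1)` whose blocks, read left to right,
are given by the list `b = [b_k, …, b_1]`: it reverses the consecutive blocks of
positions of sizes `b_k, b_{k−1}, …, b_1`. -/
def layeredPerm (b : List ℕ) : Equiv.Perm ℕ :=
  ((List.range b.length).map fun j => blockRev ((b.take j).sum) (b.getD j 0)).prod

/-- `𝓛ₙ`: the set of layered permutations in `S_n`. -/
def LayeredSet (n : ℕ) : Set (Equiv.Perm ℕ) :=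
  {w | ∃ b : List ℕ, (∀ c ∈ b, 0 < c) ∧ b.sum = n ∧ w = layeredPerm b}

/-- `v(n) = max_{w ∈ 𝓛ₙ} Υ_w` (as a real number; the set is finite and nonempty,
so the supremum is attained). -/
noncomputable def v (n : ℕ) : ℝ :=
  sSup ((fun w => ((Upsilon n w : ℚ) : ℝ)) '' LayeredSet n)

/-- The function `f(x) = x² log x − ½(1−x)² log(1−x) − ½(1+x)² log(1+x) + 2x log 2`
(natural logarithms; `Real.log 0 = 0` gives the continuous extension `f 0 = f 1 = 0`). -/
noncomputable def f (x : ℝ) : ℝ :=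
  x ^ 2 * Real.log x - (1 / 2) * (1 - x) ^ 2 * Real.log (1 - x)
    - (1 / 2) * (1 + x) ^ 2 * Real.log (1 + x) + 2 * x * Real.log 2

namespace LimitShape

/-- The product of simple transpositions spelled by a word. -/
def wordProd (l : List ℕ) : Equiv.Perm ℕ := (l.map sT).prod

lemma wordProd_append (l m : List ℕ) : wordProd (l ++ m) = wordProd l * wordProd m := by
  simp [wordProd]

lemma wordProd_singleton (a : ℕ) : wordProd [a] = sT a := by simp [wordProd]

lemma sT_mul_self (a : ℕ) : sT a * sT a = 1 := Equiv.swap_mul_self _ _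

lemma sT_apply (a p : ℕ) : sT a p = if p = a then a + 1 else if p = a + 1 then a else p :=
  Equiv.swap_apply_def _ _ _

lemma sT_comm {a b : ℕ} (h : a + 2 ≤ b) : sT a * sT b = sT b * sT a := by
  ext p
  simp only [Equiv.Perm.mul_apply, sT_apply]
  split_ifs <;> omega

lemma sT_braid (a : ℕ) : sT a * sT (a + 1) * sT a = sT (a + 1) * sT a * sT (a + 1) := by
  ext p
  simp only [Equiv.Perm.mul_apply, sT_apply]
  split_ifs <;> omega

/-- `w` fixes every point outside `(s, t]`. -/
def Supp (s t : ℕ) (w : Equiv.Perm ℕ) : Prop := ∀ p, ¬ (s < p ∧ p ≤ t) → w p = p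

lemma Supp.one (s t : ℕ) : Supp s t 1 := fun _ _ => rfl

lemma Supp.mul {s t : ℕ} {w z : Equiv.Perm ℕ} (hw : Supp s t w) (hz : Supp s t z) :
    Supp s t (w * z) := fun p hp => by
  rw [Equiv.Perm.mul_apply, hz p hp, hw p hp]

lemma Supp.sT {s t a : ℕ} (h1 : s < a) (h2 : a < t) : Supp s t (sT a) := fun p hp => by
  rw [sT_apply]; split_ifs <;> omega

lemma Supp.mono {s t s' t' : ℕ} {w : Equiv.Perm ℕ} (hw : Supp s t w) (h : s' ≤ s) (h' : t ≤ t') :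
    Supp s' t' w := fun p hp => hw p (by omega)

lemma Supp.mem {s t : ℕ} {w : Equiv.Perm ℕ} (hw : Supp s t w) {p : ℕ} (h : s < p ∧ p ≤ t) :
    s < w p ∧ w p ≤ t := by
  by_contra hc
  have := w.injective (hw _ hc)
  rw [this] at hc
  exact hc h

/-- All letters of the word lie in `(s, t)`. -/
def Letters (s t : ℕ) (l : List ℕ) : Prop := ∀ a ∈ l, s < a ∧ a < t

lemma Letters.supp {s t : ℕ} {l : List ℕ} (h : Letters s t l) : Supp s t (wordProd l) := by
  induction l with
  | nil => exact Supp.one s t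
  | cons a l ih =>
    have ha := h a (by simp)
    have : wordProd (a :: l) = sT a * wordProd l := by simp [wordProd]
    rw [this]
    exact (Supp.sT ha.1 ha.2).mul (ih fun b hb => h b (by simp [hb]))

lemma Letters.append {s t : ℕ} {l m : List ℕ} (h : Letters s t l) (h' : Letters s t m) :
    Letters s t (l ++ m) := fun a ha => by
  rcases List.mem_append.1 ha with ha | ha
  exacts [h a ha, h' a ha]

lemma Letters.of_append {s t : ℕ} {l m : List ℕ} (h : Letters s t (l ++ m)) :
    Letters s t l ∧ Letters s t m :=
  ⟨fun a ha => h a (by simp [ha]), fun a ha => h a (by simp [ha])⟩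

lemma Letters.mono {s t s' t' : ℕ} {l : List ℕ} (h : Letters s t l) (h1 : s' ≤ s) (h2 : t ≤ t') :
    Letters s' t' l := fun a ha => by have := h a ha; omega

lemma Letters.single {s t a : ℕ} (h : s < a ∧ a < t) : Letters s t [a] := fun b hb => by
  rw [List.mem_singleton.1 hb]; exact h

lemma len_mul_sT {n a : ℕ} {w : Equiv.Perm ℕ} (h1 : 0 < a) (h2 : a < n) (h : w a < w (a + 1)) :
    len n (w * sT a) = len n w + 1 := by
  classical
  unfold len
  conv_rhs => rw [← Finset.card_map ((sT a).prodCongr (sT a)).toEmbedding,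
    ← Finset.card_insert_of_notMem (a := (a, a + 1)) (by
      have hs : (sT a).symm = sT a := Equiv.symm_swap _ _
      simp only [Finset.mem_filter, Finset.mem_map_equiv, Equiv.prodCongr_symm,
        Equiv.prodCongr_apply, Prod.map, hs]
      simp [sT])]
  congr 1
  ext ⟨p, q⟩
  rw [Finset.mem_filter]
  have hs : (sT a).symm = sT a := Equiv.symm_swap _ _
  have e1 : sT a a = a + 1 := Equiv.swap_apply_left _ _
  have e2 : sT a (a + 1) = a := Equiv.swap_apply_right _ _
  have e3 : ∀ p, p ≠ a → p ≠ a + 1 → sT a p = p := fun p => Equiv.swap_apply_of_ne_of_ne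
  simp only [Finset.mem_filter, Finset.mem_product, Finset.mem_Icc, Finset.mem_insert,
    Finset.mem_map_equiv, Equiv.prodCongr_symm, Equiv.prodCongr_apply, Prod.map, hs,
    Equiv.Perm.mul_apply, Prod.mk.injEq]
  by_cases hp : p = a
  · by_cases hq : q = a + 1
    · rw [hp, hq, e1, e2]; omega
    · by_cases hq' : q = a
      · subst hp hq'; simp only [e1]; omega
      · rw [hp, e1, e3 q hq' hq]; omega
  · by_cases hp' : p = a + 1
    · by_cases hq : q = a + 1
      · subst hp' hq; simp only [e2]; omega
      · by_cases hq' : q = a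
        · subst hp' hq'; simp only [e1, e2]; omega
        · rw [hp', e2, e3 q hq' hq]; omega
    · rw [e3 p hp hp']
      by_cases hq : q = a + 1
      · rw [hq, e2]; omega
      · by_cases hq' : q = a
        · rw [hq', e1]; omega
        · rw [e3 q hq' hq]; omega

lemma len_mul_sT' {n a : ℕ} {w : Equiv.Perm ℕ} (h1 : 0 < a) (h2 : a < n) (h : w (a + 1) < w a) :
    len n w = len n (w * sT a) + 1 := by
  rw [← len_mul_sT (w := w * sT a) h1 h2 (by simpa [sT_apply] using h), mul_assoc, sT_mul_self,
    mul_one]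

lemma lt_or_gt_perm (w : Equiv.Perm ℕ) (a : ℕ) : w a < w (a + 1) ∨ w (a + 1) < w a :=
  lt_or_gt_of_ne fun h => by simpa using w.injective h

lemma len_one (n : ℕ) : len n 1 = 0 := by
  unfold len
  rw [Finset.card_eq_zero, Finset.filter_eq_empty_iff]
  rintro ⟨p, q⟩ _ h
  simp at h
  omega

lemma len_wordProd_le {n : ℕ} {l : List ℕ} (h : Letters 0 n l) :
    len n (wordProd l) ≤ l.length := by
  induction l using List.reverseRecOn with
  | nil => simp [wordProd, len_one]
  | append_singleton l a ih =>
    have ih := ih h.of_append.1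
    have ha := h a (by simp)
    rw [wordProd_append, wordProd_singleton, List.length_append, List.length_singleton]
    rcases lt_or_gt_perm (wordProd l) a with h | h
    · rw [len_mul_sT ha.1 ha.2 h]; omega
    · have := len_mul_sT' ha.1 ha.2 h; omega

lemma eq_one_of_no_descent {n : ℕ} {w : Equiv.Perm ℕ} (hw : Supp 0 n w)
    (h : ∀ a, 0 < a → a < n → w a < w (a + 1)) : w = 1 := by
  have hm : StrictMono w := strictMono_nat_of_lt_succ fun a => by
    rcases Nat.eq_zero_or_pos a with rfl | ha
    · rw [hw 0 (by omega)]
      exact Nat.pos_of_ne_zero fun h0 => by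
        have := w.injective (h0.trans (hw 0 (by omega)).symm); omega
    · rcases lt_or_ge a n with h' | h'
      · exact h a ha h'
      · rw [hw (a + 1) (by omega)]
        rcases eq_or_lt_of_le h' with h' | h'
        · have := hw.mem (p := a) (by omega); omega
        · rw [hw a (by omega)]; omega
  ext p
  have h2 : StrictMono (w⁻¹ : Equiv.Perm ℕ) := fun a b hab => by
    by_contra hc
    have := hm.monotone (not_lt.1 hc)
    simp at this; omega
  have := hm.le_apply (x := p)
  have h3 := h2.le_apply (x := w p)
  simp at h3 ⊢
  omega

lemma exists_descent {n : ℕ} {w : Equiv.Perm ℕ} (hw : Supp 0 n w) (h : w ≠ 1) :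
    ∃ a, 0 < a ∧ a < n ∧ w (a + 1) < w a := by
  by_contra hc
  push Not at hc
  refine h (eq_one_of_no_descent hw fun a h1 h2 => ?_)
  have := hc a h1 h2
  rcases lt_or_gt_perm w a with h | h <;> omega

/-- A reduced word with letters in `(0, n)`. -/
def Red (n : ℕ) (l : List ℕ) : Prop := Letters 0 n l ∧ len n (wordProd l) = l.length

lemma exists_red {n : ℕ} {w : Equiv.Perm ℕ} (hw : Supp 0 n w) : ∃ l, Red n l ∧ wordProd l = w := by
  induction hk : len n w using Nat.strong_induction_on generalizing w with
  | _ k ih =>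
    by_cases h1 : w = 1
    · exact ⟨[], ⟨fun a ha => by simp at ha, by simp [wordProd, len_one]⟩, by simp [wordProd, h1]⟩
    · obtain ⟨a, ha, han, hd⟩ := exists_descent hw h1
      have hl := len_mul_sT' ha han hd
      obtain ⟨l, hl1, hl2⟩ := ih _ (by omega) (hw.mul (Supp.sT ha han)) rfl
      have hp : wordProd (l ++ [a]) = w := by
        rw [wordProd_append, wordProd_singleton, hl2, mul_assoc, sT_mul_self, mul_one]
      refine ⟨l ++ [a], ⟨hl1.1.append (Letters.single ⟨ha, han⟩), ?_⟩, hp⟩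
      have := hl1.2
      rw [hp, List.length_append, List.length_singleton, ← this, hl2]; omega

lemma Red.init {n a : ℕ} {l : List ℕ} (h : Red n (l ++ [a])) :
    Red n l ∧ 0 < a ∧ a < n ∧ wordProd (l ++ [a]) (a + 1) < wordProd (l ++ [a]) a := by
  have ha := h.1 a (by simp)
  have h1 := len_wordProd_le h.1.of_append.1
  have h2 := h.2
  have hp : wordProd l = wordProd (l ++ [a]) * sT a := by
    rw [wordProd_append, wordProd_singleton, mul_assoc, sT_mul_self, mul_one]
  rw [List.length_append, List.length_singleton] at h2
  rcases lt_or_gt_perm (wordProd (l ++ [a])) a with hd | hd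
  · have := len_mul_sT ha.1 ha.2 hd
    rw [← hp] at this; omega
  · have := len_mul_sT' ha.1 ha.2 hd
    rw [← hp] at this
    exact ⟨⟨h.1.of_append.1, by omega⟩, ha.1, ha.2, hd⟩

lemma Red.concat {n a : ℕ} {l : List ℕ} (h : Red n l) (h1 : 0 < a) (h2 : a < n)
    (hd : wordProd l a < wordProd l (a + 1)) : Red n (l ++ [a]) := by
  refine ⟨h.1.append (Letters.single ⟨h1, h2⟩), ?_⟩
  rw [wordProd_append, wordProd_singleton, len_mul_sT h1 h2 hd, h.2]; simp

section Matsumoto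

variable {R : Type*} [Monoid R] (u : ℕ → R)

lemma matsumoto_aux {n : ℕ} (hc : ∀ a b, a + 2 ≤ b → u a * u b = u b * u a)
    (hb : ∀ a, u a * u (a + 1) * u a = u (a + 1) * u a * u (a + 1)) (k : ℕ) :
    ∀ l l' : List ℕ, Red n l → Red n l' → wordProd l = wordProd l' → l.length = k →
      (l.map u).prod = (l'.map u).prod := by
  induction k using Nat.strong_induction_on with
  | _ k ih =>
  have key : ∀ (w : Equiv.Perm ℕ) (l l' : List ℕ) (a b : ℕ), Red n (l ++ [a]) →
      Red n (l' ++ [b]) → wordProd (l ++ [a]) = w → wordProd (l' ++ [b]) = w →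
      (l ++ [a]).length = k → a < b → ((l ++ [a]).map u).prod = ((l' ++ [b]).map u).prod := by
    intro w l l' a b hl hl' hw hw' hk hab
    obtain ⟨hr, ha0, han, had⟩ := hl.init
    obtain ⟨hr', hb0, hbn, hbd⟩ := hl'.init
    have hS : Supp 0 n w := hw ▸ hl.1.supp
    have hlw : wordProd l = w * sT a := by
      rw [← hw, wordProd_append, wordProd_singleton, mul_assoc, sT_mul_self, mul_one]
    have hlw' : wordProd l' = w * sT b := by
      rw [← hw', wordProd_append, wordProd_singleton, mul_assoc, sT_mul_self, mul_one]
    rw [hw] at had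
    rw [hw'] at hbd
    have hlk : l.length < k := by rw [← hk]; simp
    have hlk' : l'.length < k := by
      have := hr.2; have h' := hr'.2
      have e1 := len_mul_sT' ha0 han had
      have e2 := len_mul_sT' hb0 hbn hbd
      rw [hlw] at this; rw [hlw'] at h'; omega
    rcases Nat.lt_or_ge b (a + 2) with hlt | hge
    · obtain rfl : b = a + 1 := by omega
      obtain ⟨m, hm, hmw⟩ := exists_red (hS.mul (((Supp.sT ha0 han).mul (Supp.sT hb0 hbn)).mul
        (Supp.sT ha0 han)))
      have hmw2 := hmw
      rw [sT_braid] at hmw2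
      have z0 : wordProd m a = w (a + 1 + 1) := by
        rw [hmw]; simp only [Equiv.Perm.mul_apply, sT_apply]; congr 1; split_ifs <;> omega
      have z1 : wordProd m (a + 1) = w (a + 1) := by
        rw [hmw]; simp only [Equiv.Perm.mul_apply, sT_apply]; congr 1; split_ifs <;> omega
      have z2 : wordProd m (a + 1 + 1) = w a := by
        rw [hmw]; simp only [Equiv.Perm.mul_apply, sT_apply]; congr 1; split_ifs <;> omega
      have s1 : sT (a + 1) a = a := Equiv.swap_apply_of_ne_of_ne (by omega) (by omega)
      have s2 : sT a (a + 1 + 1) = a + 1 + 1 :=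
        Equiv.swap_apply_of_ne_of_ne (by omega) (by omega)
      have s3 : ∀ a, sT a a = a + 1 := fun a => Equiv.swap_apply_left _ _
      have s4 : ∀ a, sT a (a + 1) = a := fun a => Equiv.swap_apply_right _ _
      have m1 : Red n (m ++ [a]) := hm.concat ha0 han (by rw [z0, z1]; exact hbd)
      have m2 : Red n (m ++ [a] ++ [a + 1]) := m1.concat hb0 hbn (by
        rw [wordProd_append, wordProd_singleton, Equiv.Perm.mul_apply, Equiv.Perm.mul_apply,
          s4, s2, z0, z2]; exact hbd.trans had)
      have m1' : Red n (m ++ [a + 1]) := hm.concat hb0 hbn (by rw [z1, z2]; exact had)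
      have m2' : Red n (m ++ [a + 1] ++ [a]) := m1'.concat ha0 han (by
        rw [wordProd_append, wordProd_singleton, Equiv.Perm.mul_apply, Equiv.Perm.mul_apply,
          s3, s1, z0, z2]; exact hbd.trans had)
      have e1 := ih _ hlk l (m ++ [a] ++ [a + 1]) hr m2 (by
        rw [wordProd_append, wordProd_append, wordProd_singleton, wordProd_singleton, hmw2, hlw]
        have h1 := sT_mul_self a
        have h2 := sT_mul_self (a + 1)
        rw [mul_assoc w, mul_assoc w, ← sT_braid, mul_assoc (sT a * sT (a + 1)), h1, mul_one,
          mul_assoc (sT a), h2, mul_one]) rfl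
      have e2 := ih _ hlk' l' (m ++ [a + 1] ++ [a]) hr' m2' (by
        rw [wordProd_append, wordProd_append, wordProd_singleton, wordProd_singleton, hmw, hlw']
        have h1 := sT_mul_self a
        have h2 := sT_mul_self (a + 1)
        rw [mul_assoc w, mul_assoc w, sT_braid, mul_assoc (sT (a + 1) * sT a), h2, mul_one,
          mul_assoc (sT (a + 1)), h1, mul_one]) rfl
      rw [List.map_append, List.prod_append, e1, List.map_append (l₁ := l'), List.prod_append, e2]
      simp only [List.map_append, List.prod_append, List.map_cons, List.map_nil, List.prod_cons,
        List.prod_nil, mul_one]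
      rw [mul_assoc, mul_assoc, mul_assoc, mul_assoc, ← mul_assoc (u a), ← mul_assoc (u (a + 1)),
        hb]
    · obtain ⟨m, hm, hmw⟩ := exists_red (hS.mul ((Supp.sT ha0 han).mul (Supp.sT hb0 hbn)))
      have s1 : ∀ p, p ≠ b → p ≠ b + 1 → sT b p = p := fun p => Equiv.swap_apply_of_ne_of_ne
      have s2 : ∀ p, p ≠ a → p ≠ a + 1 → sT a p = p := fun p => Equiv.swap_apply_of_ne_of_ne
      have s3 : ∀ a, sT a a = a + 1 := fun a => Equiv.swap_apply_left _ _
      have s4 : ∀ a, sT a (a + 1) = a := fun a => Equiv.swap_apply_right _ _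
      have m1 : Red n (m ++ [a]) := hm.concat ha0 han (by
        rw [hmw]
        simp only [Equiv.Perm.mul_apply]
        rw [s1 a (by omega) (by omega), s1 (a + 1) (by omega) (by omega), s3, s4]; exact had)
      have m1' : Red n (m ++ [b]) := hm.concat hb0 hbn (by
        rw [hmw]
        simp only [Equiv.Perm.mul_apply]
        rw [s3, s4, s2 b (by omega) (by omega), s2 (b + 1) (by omega) (by omega)]; exact hbd)
      have e1 := ih _ hlk l (m ++ [b]) hr m1' (by
        rw [wordProd_append, wordProd_singleton, hmw, hlw, mul_assoc, mul_assoc, sT_mul_self,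
          mul_one]) rfl
      have e2 := ih _ hlk' l' (m ++ [a]) hr' m1 (by
        rw [wordProd_append, wordProd_singleton, hmw, hlw', sT_comm hge, mul_assoc, mul_assoc,
          sT_mul_self, mul_one]) rfl
      rw [List.map_append, List.prod_append, e1, List.map_append (l₁ := l'), List.prod_append, e2]
      simp [mul_assoc, hc a b hge]
  intro l l' hl hl' hp hk
  have hk' : l'.length = k := by rw [← hl'.2, ← hp, hl.2, hk]
  rcases List.eq_nil_or_concat' l with rfl | ⟨m, a, rfl⟩
  · simp at hk; subst hk; simp [List.length_eq_zero_iff.1 hk']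
  rcases List.eq_nil_or_concat' l' with rfl | ⟨m', b, rfl⟩
  · simp at hk hk'; omega
  rcases lt_trichotomy a b with h | rfl | h
  · exact key _ m m' a b hl hl' rfl hp.symm hk h
  · rw [List.map_append, List.prod_append, List.map_append, List.prod_append]
    rw [wordProd_append, wordProd_append, mul_left_inj] at hp
    rw [ih m.length (by rw [← hk]; simp) m m' hl.init.1 hl'.init.1 hp rfl]
  · exact (key _ m' m b a hl' hl rfl hp hk' h).symm

/-- Matsumoto's theorem: the image of a reduced word only depends on its product. -/
lemma matsumoto {n : ℕ} (hc : ∀ a b, a + 2 ≤ b → u a * u b = u b * u a)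
    (hb : ∀ a, u a * u (a + 1) * u a = u (a + 1) * u a * u (a + 1)) {l l' : List ℕ}
    (hl : Red n l) (hl' : Red n l') (h : wordProd l = wordProd l') :
    (l.map u).prod = (l'.map u).prod :=
  matsumoto_aux u hc hb _ l l' hl hl' h rfl

end Matsumoto

lemma nil_word {R : Type*} [MonoidWithZero R] (u : ℕ → R) {n : ℕ}
    (hc : ∀ a b, a + 2 ≤ b → u a * u b = u b * u a)
    (hb : ∀ a, u a * u (a + 1) * u a = u (a + 1) * u a * u (a + 1)) (h0 : ∀ a, u a * u a = 0)
    {l : List ℕ} (hl : Letters 0 n l) (hr : ¬ Red n l) : (l.map u).prod = 0 := by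
  induction l using List.reverseRecOn with
  | nil => exact absurd ⟨hl, by simp [wordProd, len_one]⟩ hr
  | append_singleton l a ih =>
    rw [List.map_append, List.prod_append]
    by_cases h : Red n l
    · have ha := hl a (by simp)
      rcases lt_or_gt_perm (wordProd l) a with hd | hd
      · exact absurd (h.concat ha.1 ha.2 hd) hr
      · obtain ⟨m, hm, hmw⟩ := exists_red (h.1.supp.mul (Supp.sT ha.1 ha.2))
        have hm' : Red n (m ++ [a]) := hm.concat ha.1 ha.2 (by
          rw [hmw]; simpa [sT_apply] using hd)
        rw [matsumoto u hc hb h hm' (by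
          rw [wordProd_append, hmw, wordProd_singleton, mul_assoc, sT_mul_self, mul_one])]
        simp [mul_assoc, h0]
    · rw [ih hl.of_append.1 h, zero_mul]

end LimitShape

namespace LimitShape

open MvPolynomial

/-- The ambient polynomial ring. -/
abbrev Poly := MvPolynomial ℕ ℚ

/-- The simple transposition `(a, a+1)` acting on variables. -/
noncomputable def sw (a : ℕ) : Poly →ₐ[ℚ] Poly := rename (sT a)

/-- The difference of two neighbouring variables. -/
noncomputable def dv (a : ℕ) : Poly := X a - X (a + 1)

lemma sT_sT (a p : ℕ) : sT a (sT a p) = p := Equiv.swap_apply_self _ _ _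

lemma sw_sw (a : ℕ) (g : Poly) : sw a (sw a g) = g := by
  rw [sw, rename_rename]
  have : (sT a : ℕ → ℕ) ∘ sT a = id := funext fun p => sT_sT a p
  rw [this, rename_id_apply]

lemma sw_X (a i : ℕ) : sw a (X i) = X (sT a i) := rename_X _ _

lemma sw_C (a : ℕ) (c : ℚ) : sw a (C c) = C c := rename_C _ _

lemma sT_left (a : ℕ) : sT a a = a + 1 := Equiv.swap_apply_left _ _

lemma sT_right (a : ℕ) : sT a (a + 1) = a := Equiv.swap_apply_right _ _

lemma sT_ne {a p : ℕ} (h : p ≠ a) (h' : p ≠ a + 1) : sT a p = p :=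
  Equiv.swap_apply_of_ne_of_ne h h'

lemma dv_ne (a : ℕ) : dv a ≠ 0 := by
  rw [dv, sub_ne_zero]
  intro h
  have := X_injective (R := ℚ) h
  omega

lemma sw_dv (a : ℕ) : sw a (dv a) = - dv a := by
  rw [dv, map_sub, sw_X, sw_X, sT_left, sT_right]; ring

lemma dd_exists (a : ℕ) (g : Poly) : ∃ h, dv a * h = g - sw a g := by
  induction g using MvPolynomial.induction_on with
  | C c => exact ⟨0, by rw [sw_C]; simp⟩
  | add p q hp hq =>
    obtain ⟨h, hh⟩ := hp
    obtain ⟨k, hk⟩ := hq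
    exact ⟨h + k, by rw [map_add]; linear_combination hh + hk⟩
  | mul_X p i hp =>
    obtain ⟨h, hh⟩ := hp
    have : ∃ e : Poly, dv a * e = X i - sw a (X i) := by
      rw [sw_X]
      by_cases h1 : i = a
      · exact ⟨1, by rw [h1, sT_left, dv]; ring⟩
      · by_cases h2 : i = a + 1
        · exact ⟨-1, by rw [h2, sT_right, dv]; ring⟩
        · exact ⟨0, by rw [sT_ne h1 h2]; ring⟩
    obtain ⟨e, he⟩ := this
    exact ⟨h * X i + sw a p * e, by rw [map_mul]; linear_combination X i * hh + sw a p * he⟩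

lemma dv_cancel {a : ℕ} {g h : Poly} (e : dv a * g = dv a * h) : g = h :=
  mul_left_cancel₀ (dv_ne a) e

/-- The divided difference operator `(g - s_a g) / (x_a - x_{a+1})`. -/
noncomputable def dd (a : ℕ) : Poly →ₗ[ℚ] Poly where
  toFun g := (dd_exists a g).choose
  map_add' g h := dv_cancel (a := a) (by
    rw [mul_add, (dd_exists a _).choose_spec, (dd_exists a _).choose_spec,
      (dd_exists a _).choose_spec, map_add]; ring)
  map_smul' c g := dv_cancel (a := a) (by
    rw [mul_smul_comm, (dd_exists a _).choose_spec, (dd_exists a _).choose_spec, map_smul,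
      smul_sub, RingHom.id_apply])

lemma dd_spec (a : ℕ) (g : Poly) : dv a * dd a g = g - sw a g := (dd_exists a g).choose_spec

lemma dd_of_inv {a : ℕ} {g : Poly} (h : sw a g = g) : dd a g = 0 :=
  dv_cancel (a := a) (by rw [dd_spec, h]; simp)

lemma sw_dd (a : ℕ) (g : Poly) : sw a (dd a g) = dd a g :=
  dv_cancel (a := a) (by
    have := congrArg (sw a) (dd_spec a g)
    rw [map_mul, sw_dv, map_sub, sw_sw] at this
    linear_combination -this - dd_spec a g)

lemma dd_dd (a : ℕ) : dd a * dd a = 0 := by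
  refine LinearMap.ext fun g => ?_
  exact dd_of_inv (sw_dd a g)

lemma sw_comm {a b : ℕ} (h : a + 2 ≤ b) (g : Poly) : sw a (sw b g) = sw b (sw a g) := by
  rw [sw, sw, rename_rename, rename_rename]
  congr 2
  funext p
  exact DFunLike.congr_fun (sT_comm h) p

lemma sw_braid (a : ℕ) (g : Poly) :
    sw a (sw (a + 1) (sw a g)) = sw (a + 1) (sw a (sw (a + 1) g)) := by
  simp only [sw, rename_rename]
  congr 2
  funext p
  exact DFunLike.congr_fun (sT_braid a) p

lemma dd_comm (a b : ℕ) (h : a + 2 ≤ b) : dd a * dd b = dd b * dd a := by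
  refine LinearMap.ext fun g => ?_
  change dd a (dd b g) = dd b (dd a g)
  have h1 : sw a (dv b) = dv b := by
    rw [dv, map_sub, sw_X, sw_X, sT_ne (by omega) (by omega), sT_ne (by omega) (by omega)]
  have h2 : sw b (dv a) = dv a := by
    rw [dv, map_sub, sw_X, sw_X, sT_ne (by omega) (by omega), sT_ne (by omega) (by omega)]
  refine dv_cancel (a := a) (dv_cancel (a := b) ?_)
  have e1 := dd_spec a (dd b g)
  have e2 := dd_spec b g
  have e3 := congrArg (sw a) e2
  have e4 := dd_spec b (dd a g)
  have e5 := dd_spec a g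
  have e6 := congrArg (sw b) e5
  rw [map_mul, map_sub, h1] at e3
  rw [map_mul, map_sub, h2] at e6
  have := sw_comm h g
  linear_combination dv b * e1 + e2 - e3 - dv a * e4 - e5 + e6 + this

lemma dd_braid (a : ℕ) : dd a * dd (a + 1) * dd a = dd (a + 1) * dd a * dd (a + 1) := by
  refine LinearMap.ext fun g => ?_
  change dd a (dd (a + 1) (dd a g)) = dd (a + 1) (dd a (dd (a + 1) g))
  set b := a + 1 with hb
  have h3 : sw a (dv b) = dv a + dv b := by
    rw [dv, dv, map_sub, sw_X, sw_X, sT_right, sT_ne (by omega) (by omega)]; ring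
  have h3' : sw b (dv a) = dv a + dv b := by
    rw [dv, dv, map_sub, sw_X, sw_X, ← hb, sT_left, sT_ne (by omega) (by omega)]; ring
  have h0 : dv a + dv b ≠ 0 := by
    have : dv a + dv b = X a - X (b + 1) := by rw [dv, dv, ← hb]; ring
    rw [this, sub_ne_zero]
    intro h
    have := X_injective (R := ℚ) h
    omega
  refine dv_cancel (a := a) (dv_cancel (a := b) (mul_left_cancel₀ h0 ?_))
  have key : ∀ a b : ℕ, sw a (dv b) = dv a + dv b → sw b (dv a) = dv a + dv b →
      dv a * dv b * (dv a + dv b) * dd a (dd b (dd a g)) =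
        g - sw a g - sw b g + sw b (sw a g) + sw a (sw b g) - sw a (sw b (sw a g)) := by
    intro a b h h'
    have e1 := dd_spec a (dd b (dd a g))
    have e2 := dd_spec b (dd a g)
    have e3 := dd_spec a g
    have e2a := congrArg (sw a) e2
    have e3b := congrArg (sw b) e3
    have e3ab := congrArg (sw a) e3b
    have hs := sw_dv a
    have hsd := sw_dd a g
    simp only [map_mul, map_sub, map_add, h, h', hs, hsd] at e2a e3b e3ab
    linear_combination dv b * (dv a + dv b) * e1 + (dv a + dv b) * e2 - dv b * e2a + e3 - e3b
      + e3ab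
  have k1 := key a b h3 h3'
  have k2 := key b a (by rw [h3', add_comm]) (by rw [h3, add_comm])
  have := sw_braid a g
  rw [← hb] at this
  linear_combination k1 - k2 - this

/-- The sum of all partial derivatives. -/
noncomputable def nab : Derivation ℚ Poly Poly := mkDerivation ℚ fun _ => 1

/-- The Euler operator. -/
noncomputable def eul : Derivation ℚ Poly Poly := mkDerivation ℚ fun i => X i

lemma nab_X (i : ℕ) : nab (X i) = 1 := mkDerivation_X _ _ _

lemma eul_X (i : ℕ) : eul (X i) = X i := mkDerivation_X _ _ _

lemma nab_sw (a : ℕ) (g : Poly) : nab (sw a g) = sw a (nab g) := by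
  induction g using MvPolynomial.induction_on with
  | C c => rw [sw_C]; simp [nab]
  | add p q hp hq => simp only [map_add, hp, hq]
  | mul_X p i hp => simp only [map_mul, Derivation.leibniz, hp, sw_X, nab_X, smul_eq_mul, map_add,
      map_one]

lemma eul_sw (a : ℕ) (g : Poly) : eul (sw a g) = sw a (eul g) := by
  induction g using MvPolynomial.induction_on with
  | C c => rw [sw_C]; simp [eul]
  | add p q hp hq => simp only [map_add, hp, hq]
  | mul_X p i hp => simp only [map_mul, Derivation.leibniz, hp, sw_X, eul_X, smul_eq_mul, map_add]

lemma nab_dd (a : ℕ) (g : Poly) : nab (dd a g) = dd a (nab g) :=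
  dv_cancel (a := a) (by
    have h := congrArg nab (dd_spec a g)
    have h0 : nab (dv a) = 0 := by rw [dv, map_sub, nab_X, nab_X, sub_self]
    rw [Derivation.leibniz, h0, map_sub, nab_sw, smul_zero, add_zero, smul_eq_mul] at h
    rw [h, dd_spec])

lemma eul_dd (a : ℕ) (g : Poly) : dd a (eul g) = dd a g + eul (dd a g) :=
  dv_cancel (a := a) (by
    have h := congrArg eul (dd_spec a g)
    have h0 : eul (dv a) = dv a := by rw [dv, map_sub, eul_X, eul_X]
    rw [Derivation.leibniz, h0, map_sub, eul_sw, smul_eq_mul, smul_eq_mul] at h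
    rw [dd_spec]; linear_combination -h)

lemma nab_eul (g : Poly) : nab (eul g) = nab g + eul (nab g) := by
  have : ⁅nab, eul⁆ = nab := by
    refine MvPolynomial.derivation_ext fun i => ?_
    rw [Derivation.commutator_apply, eul_X, nab_X]; simp
  have h := DFunLike.congr_fun this g
  rw [Derivation.commutator_apply] at h
  linear_combination h

/-- `g` is homogeneous of degree `d`, in terms of the Euler operator. -/
def Hom (d : ℕ) (g : Poly) : Prop := eul g = (d : ℚ) • g

lemma Hom.dd {d : ℕ} {g : Poly} (h : Hom (d + 1) g) (a : ℕ) : Hom d (dd a g) := by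
  have := eul_dd a g
  rw [h, map_smul] at this
  unfold Hom
  push_cast at this
  rw [add_smul, one_smul, add_comm] at this
  exact (add_left_cancel this).symm

lemma Hom.nab {d : ℕ} {g : Poly} (h : Hom (d + 1) g) : Hom d (nab g) := by
  have := nab_eul g
  rw [h, Derivation.map_smul] at this
  unfold Hom
  push_cast at this
  rw [add_smul, one_smul, add_comm] at this
  exact (add_left_cancel this).symm

lemma Hom.add {d : ℕ} {g h : Poly} (hg : Hom d g) (hh : Hom d h) : Hom d (g + h) := by
  unfold Hom at *; rw [map_add, hg, hh, smul_add]

lemma Hom.smul {d : ℕ} {g : Poly} (c : ℚ) (hg : Hom d g) : Hom d (c • g) := by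
  unfold Hom at *; rw [Derivation.map_smul, hg, smul_comm]

lemma eul_monomial (m : ℕ →₀ ℕ) (c : ℚ) :
    eul (monomial m c) = (m.degree : ℚ) • monomial m c := by
  rw [eul, mkDerivation_monomial, Finsupp.sum]
  have : ∀ i ∈ m.support, (monomial (m - Finsupp.single i 1)) ((m i : ℕ) : ℚ) • (X i : Poly)
      = (m i : ℚ) • monomial m 1 := by
    intro i hi
    have h1 : 1 ≤ m i := Nat.one_le_iff_ne_zero.2 (Finsupp.mem_support_iff.1 hi)
    rw [smul_eq_mul, X, monomial_mul, smul_monomial]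
    rw [tsub_add_cancel_of_le (Finsupp.single_le_iff.2 h1)]
    simp
  rw [Finset.sum_congr rfl this, ← Finset.sum_smul, Finsupp.degree, ← Nat.cast_sum, smul_comm,
    smul_monomial, smul_eq_mul, mul_one]
  rfl

lemma coeff_eul (m : ℕ →₀ ℕ) (g : Poly) : coeff m (eul g) = m.degree * coeff m g := by
  induction g using MvPolynomial.induction_on' with
  | monomial k c =>
    rw [eul_monomial, coeff_smul, coeff_monomial, smul_eq_mul]
    split_ifs with h
    · rw [h]
    · simp
  | add p q hp hq => rw [map_add, coeff_add, hp, hq, coeff_add]; ring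

lemma Hom.degree_eq {d : ℕ} {g : Poly} (h : Hom d g) {m : ℕ →₀ ℕ} (hm : coeff m g ≠ 0) :
    m.degree = d := by
  have := coeff_eul m g
  rw [h, coeff_smul, smul_eq_mul] at this
  exact_mod_cast (mul_right_cancel₀ hm this).symm

/-- Evaluation at `(1, 1, …)`. -/
noncomputable def ev : Poly →ₐ[ℚ] ℚ := aeval fun _ => 1

lemma Hom.const {g : Poly} (h : Hom 0 g) : g = C (ev g) := by
  have : g = C (coeff 0 g) := by
    ext m
    rw [coeff_C]
    split_ifs with h0
    · rw [h0]
    · by_contra hc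
      have := h.degree_eq hc
      rw [Finsupp.degree_eq_zero_iff] at this
      exact h0 this.symm
  rw [this]; simp [ev]

lemma ev_eul (g : Poly) : ev (eul g) = ev (nab g) := by
  induction g using MvPolynomial.induction_on with
  | C c => simp [eul, nab]
  | add p q hp hq => simp only [map_add, hp, hq]
  | mul_X p i hp => 
    simp only [Derivation.leibniz, eul_X, nab_X, smul_eq_mul, map_add, map_mul, hp, map_one]
    have : ev (X i : Poly) = 1 := aeval_X _ _
    rw [this]

lemma nab_iter {d : ℕ} {g : Poly} (h : Hom d g) :
    ((nab : Poly →ₗ[ℚ] Poly) ^ d) g = C (d.factorial * ev g) := by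
  induction d generalizing g with
  | zero => rw [pow_zero, Nat.factorial_zero]; simpa using h.const
  | succ d ih =>
    rw [pow_succ, Module.End.mul_apply]
    have h1 := ih h.nab
    have h2 := ev_eul g
    rw [h, map_smul] at h2
    refine h1.trans ?_
    rw [← h2, Nat.factorial_succ]
    push_cast
    rw [smul_eq_mul]; ring_nf

/-- Polynomials whose exponents are bounded by the staircase. -/
def Stair (M : ℕ) (g : Poly) : Prop := ∀ i, degreeOf i g ≤ if i = 0 then 0 else M - i

lemma Stair.add {M : ℕ} {g h : Poly} (hg : Stair M g) (hh : Stair M h) : Stair M (g + h) :=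
  fun i => (degreeOf_add_le i g h).trans (max_le (hg i) (hh i))

lemma degreeOf_smul_le' (i : ℕ) (c : ℚ) (g : Poly) : degreeOf i (c • g) ≤ degreeOf i g := by
  rw [degreeOf_le_iff]
  intro m hm
  exact degreeOf_le_iff.1 le_rfl m (support_smul hm)

lemma Stair.smul {M : ℕ} {g : Poly} (c : ℚ) (hg : Stair M g) : Stair M (c • g) :=
  fun i => (degreeOf_smul_le' i c g).trans (hg i)

lemma Stair.zero (M : ℕ) : Stair M 0 := fun i => by simp

lemma Stair.sum {ι : Type*} {M : ℕ} (s : Finset ι) (F : ι → Poly) (h : ∀ i ∈ s, Stair M (F i)) :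
    Stair M (∑ i ∈ s, F i) :=
  Finset.sum_induction _ _ (fun _ _ => Stair.add) (Stair.zero M) h

lemma degreeOf_dv (i a : ℕ) (h : i ≠ a) (h' : i ≠ a + 1) : degreeOf i (dv a) = 0 := by
  have := degreeOf_sub_le i (X a : Poly) (X (a + 1))
  rw [degreeOf_X_of_ne h, degreeOf_X_of_ne h'] at this
  simpa [dv] using this

lemma degreeOf_dv_pos (i a : ℕ) (h : i = a ∨ i = a + 1) : 1 ≤ degreeOf i (dv a) := by
  by_contra hc
  have h0 : degreeOf i (dv a) ≤ 0 := by omega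
  have := degreeOf_le_iff.1 h0 (Finsupp.single i 1) (by
    rw [mem_support_iff, dv, coeff_sub, coeff_X, coeff_X]
    simp only [Finsupp.single_left_inj (one_ne_zero)]
    rcases h with rfl | rfl <;> simp)
  simp at this

lemma degreeOf_sw (i a : ℕ) (g : Poly) : degreeOf i (sw a g) = degreeOf (sT a i) g := by
  have := degreeOf_rename_of_injective (p := g) (sT a).injective (sT a i)
  rwa [sT_sT] at this

lemma Stair.dd {M a : ℕ} (ha : 0 < a) (haM : a < M) {g : Poly} (hg : Stair M g) :
    Stair M (dd a g) := by
  intro i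
  by_cases h0 : LimitShape.dd a g = 0
  · simp [h0]
  have h1 := congrArg (degreeOf i) (dd_spec a g)
  rw [degreeOf_mul_eq (dv_ne a) h0] at h1
  have h2 := degreeOf_sub_le i g (sw a g)
  rw [← h1, degreeOf_sw] at h2
  have h3 := hg i
  have h4 := hg (sT a i)
  by_cases e1 : i = a
  · have := degreeOf_dv_pos i a (Or.inl e1)
    rw [e1, sT_left, if_neg (by omega)] at h4
    rw [if_neg (by omega)] at h3 ⊢
    subst e1
    rcases le_max_iff.1 h2 with h | h <;> rw [max_def] at h2 <;> split_ifs at h2 <;> 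
      (try rw [sT_left] at *) <;> omega
  · by_cases e2 : i = a + 1
    · have := degreeOf_dv_pos i a (Or.inr e2)
      rw [e2, sT_right, if_neg (by omega)] at h4
      rw [if_neg (by omega)] at h3 ⊢
      rw [e2, sT_right, max_def] at h2
      rw [e2] at this h3 ⊢
      split_ifs at h2 <;> omega
    · rw [degreeOf_dv i a e1 e2, sT_ne e1 e2, max_self] at h2
      omega

lemma Stair.nab {M : ℕ} {g : Poly} (hg : Stair M g) : Stair M (nab g) := by
  rw [MvPolynomial.as_sum g, map_sum]
  refine Stair.sum _ _ fun m hm => ?_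
  rw [LimitShape.nab, mkDerivation_monomial]
  refine Stair.smul _ (Stair.sum _ _ fun j _ => ?_)
  change Stair M (_ • (1 : Poly))
  rw [smul_eq_mul, mul_one]
  intro i
  have := degreeOf_le_iff.1 (hg i) m hm
  refine degreeOf_le_iff.2 fun k hk => ?_
  rw [Finset.mem_singleton.1 (support_monomial_subset hk)]
  refine le_trans ?_ this
  simp

/-- The operator `∑ a ∂_a`. -/
noncomputable def bigD (M : ℕ) : Poly →ₗ[ℚ] Poly := ∑ a ∈ Finset.Ico 1 M, (a : ℚ) • dd a

lemma bigD_apply (M : ℕ) (g : Poly) : bigD M g = ∑ a ∈ Finset.Ico 1 M, (a : ℚ) • dd a g := by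
  simp [bigD]

lemma nab_bigD (M : ℕ) (g : Poly) : nab (bigD M g) = bigD M (nab g) := by
  simp only [bigD_apply, map_sum, Derivation.map_smul, nab_dd]

lemma Stair.bigD {M : ℕ} {g : Poly} (hg : Stair M g) : Stair M (bigD M g) := by
  rw [bigD_apply]
  refine Stair.sum _ _ fun a ha => Stair.smul _ (hg.dd ?_ ?_) <;>
    (have := Finset.mem_Ico.1 ha; omega)

lemma Hom.sum {ι : Type*} {d : ℕ} (s : Finset ι) (F : ι → Poly) (h : ∀ i ∈ s, Hom d (F i)) :
    Hom d (∑ i ∈ s, F i) :=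
  Finset.sum_induction _ _ (fun _ _ => Hom.add) (by simp [Hom]) h

lemma Hom.bigD {M d : ℕ} {g : Poly} (hg : Hom (d + 1) g) : Hom d (bigD M g) := by
  rw [bigD_apply]
  exact Hom.sum _ _ fun a _ => (hg.dd a).smul _

lemma bigD_linear {M : ℕ} {g : Poly} (hg : Hom 1 g) (hs : Stair M g) : bigD M g = nab g := by
  rw [MvPolynomial.as_sum g, map_sum, map_sum]
  refine Finset.sum_congr rfl fun m hm => ?_
  have hd := hg.degree_eq (mem_support_iff.1 hm)
  obtain ⟨i, rfl⟩ : ∃ i, m = Finsupp.single i 1 := by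
    exact (Finsupp.sum_eq_one_iff m).mp hd
  have hi := degreeOf_le_iff.1 (hs i) _ hm
  rw [Finsupp.single_eq_same] at hi
  have h1 : 1 ≤ i ∧ i < M := by split_ifs at hi <;> omega
  have hX : monomial (Finsupp.single i 1) (coeff (Finsupp.single i 1) g)
      = (coeff (Finsupp.single i 1) g) • (X i : Poly) := by
    rw [X, smul_monomial, smul_eq_mul, mul_one]
  rw [hX, map_smul, Derivation.map_smul, nab_X, bigD_apply]
  congr 1
  have hdX : ∀ a, dd a (X i : Poly) = if a = i then 1 else if a + 1 = i then -1 else 0 := by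
    intro a
    refine dv_cancel (a := a) ?_
    rw [dd_spec, sw_X, sT_apply, dv]
    split_ifs <;> first | omega | (subst_vars; ring)
  simp only [hdX]
  obtain ⟨k, rfl⟩ : ∃ k, i = k + 1 := ⟨i - 1, by omega⟩
  have : ∀ a : ℕ, (a : ℚ) • (if a = k + 1 then 1 else if a + 1 = k + 1 then -1 else 0 : Poly) =
      (if a = k + 1 then ((k + 1 : ℕ) : ℚ) • 1 else 0) + if a = k then (-(k : ℚ)) • 1 else 0 := by
    intro a
    split_ifs <;> first | omega | (subst_vars; simp)
  simp only [this, Finset.sum_add_distrib, Finset.sum_ite_eq', Finset.mem_Ico]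
  rw [if_pos (by omega)]
  split_ifs with hk
  · rw [← add_smul]; simp
  · have : k = 0 := by omega
    subst this; simp

lemma macdonald {M d : ℕ} {g : Poly} (hg : Hom d g) (hs : Stair M g) :
    (bigD M ^ d) g = C (d.factorial * ev g) := by
  rw [← nab_iter hg]
  induction d generalizing g with
  | zero => rfl
  | succ d ih =>
    rw [pow_succ, Module.End.mul_apply, ih hg.bigD hs.bigD, pow_succ', Module.End.mul_apply]
    have hc : ∀ d, ((nab : Poly →ₗ[ℚ] Poly) ^ d) (bigD M g)
        = bigD M (((nab : Poly →ₗ[ℚ] Poly) ^ d) g) := by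
      intro d
      induction d with
      | zero => rfl
      | succ d ih =>
        rw [pow_succ', Module.End.mul_apply, ih, Module.End.mul_apply]
        exact nab_bigD M _
    have hn : ∀ d e g, Hom (d + e) g → Stair M g → Hom e (((nab : Poly →ₗ[ℚ] Poly) ^ d) g) ∧
        Stair M (((nab : Poly →ₗ[ℚ] Poly) ^ d) g) := by
      intro d
      induction d with
      | zero => intro e g h h'; exact ⟨by simpa using h, h'⟩
      | succ d ih =>
        intro e g h h'
        rw [pow_succ, Module.End.mul_apply]
        exact ih e _ (Hom.nab (by rwa [show d + e + 1 = d + 1 + e by ring])) h'.nab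
    rw [hc]
    exact bigD_linear (hn d 1 g hg hs).1 (hn d 1 g hg hs).2

end LimitShape

namespace LimitShape

open MvPolynomial

/-- `chs l c p` is the complete homogeneous symmetric polynomial of degree `p + 1 - c` in the `c`
variables `x_{l+1}, …, x_{l+c}`. -/
noncomputable def chs (l : ℕ) : ℕ → ℕ → Poly
  | 0, _ => 0
  | c + 1, 0 => if c = 0 then 1 else 0
  | c + 1, p + 1 => chs l c p + X (l + c + 1) * chs l (c + 1) p

lemma chs_zero (l p : ℕ) : chs l 0 p = 0 := by rw [chs]

lemma chs_succ_zero (l c : ℕ) : chs l (c + 1) 0 = if c = 0 then 1 else 0 := by rw [chs]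

lemma chs_succ_succ (l c p : ℕ) :
    chs l (c + 1) (p + 1) = chs l c p + X (l + c + 1) * chs l (c + 1) p := by rw [chs]

lemma chs_shift (l c p : ℕ) :
    chs l (c + 1) (p + 1) = chs (l + 1) c p + X (l + 1) * chs l (c + 1) p := by
  induction p generalizing c with
  | zero =>
    rcases c with _ | c
    · rw [chs_succ_succ, chs_zero, chs_zero, add_zero]
    · rw [chs_succ_succ, chs_succ_zero, chs_succ_zero, chs_succ_zero]; simp
  | succ p ih =>
    rcases c with _ | c
    · rw [chs_succ_succ, chs_zero, chs_zero, add_zero]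
    · have e1 := ih c
      have e2 := ih (c + 1)
      have e3 := chs_succ_succ l (c + 1) p
      rw [chs_succ_succ, chs_succ_succ (l + 1)]
      rw [show l + 1 + c + 1 = l + (c + 1) + 1 by ring]
      linear_combination e1 + X (l + (c + 1) + 1) * e2 - X (l + 1) * e3

lemma det_chs (M : ℕ) : ∀ (l : ℕ) (e : ℕ → ℕ),
    (Matrix.of fun i j : Fin M => chs l (i + 1) (e i + j)).det
      = ∏ i : Fin M, (X (l + i + 1) : Poly) ^ e i := by
  induction M with
  | zero => intro l e; simp
  | succ M ih =>
    intro l e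
    rw [Matrix.det_eq_of_forall_col_eq_smul_add_pred (B := Matrix.of fun i j : Fin (M + 1) =>
      if (j : ℕ) = 0 then chs l (i + 1) (e i) else chs (l + 1) i (e i + (j - 1)))
      (fun _ => X (l + 1))]
    · have h1 : ∀ p, chs l 1 p = X (l + 1) ^ p := by
        intro p
        induction p with
        | zero => rw [chs_succ_zero]; simp
        | succ p ih => rw [chs_succ_succ, ih, chs_zero, pow_succ]; ring
      rw [Matrix.det_succ_row_zero, Finset.sum_eq_single 0]
      · rw [Fin.prod_univ_succ, Matrix.submatrix]
        simp only [Matrix.of_apply, Fin.val_zero, if_true, Fin.zero_succAbove, Fin.val_succ]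
        have := ih (l + 1) (fun i => e (i + 1))
        simp only [Nat.add_sub_cancel, Nat.succ_ne_zero, if_false, pow_zero, one_mul, zero_add, h1]
        rw [this]
        simp only [add_zero, add_assoc, add_comm 1]
      · intro j _ hj
        have : (j : ℕ) ≠ 0 := fun h => hj (Fin.ext h)
        simp [hj, chs_zero]
      · simp
    · intro i; simp
    · intro i j
      simp only [Matrix.of_apply, Fin.val_succ, Fin.val_castSucc, Nat.succ_ne_zero, if_false,
        Nat.add_sub_cancel]
      rw [← add_assoc, chs_shift]

lemma sw_chs_of_lt {a c : ℕ} (h : c < a) (p : ℕ) : sw a (chs 0 c p) = chs 0 c p := by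
  induction p generalizing c with
  | zero =>
    rcases c with _ | c
    · rw [chs_zero, map_zero]
    · rw [chs_succ_zero]; split_ifs <;> simp
  | succ p ih =>
    rcases c with _ | c
    · rw [chs_zero, map_zero]
    · rw [chs_succ_succ, map_add, map_mul, ih h, ih (by omega), sw_X,
        sT_ne (by omega) (by omega)]

lemma dv_mul_chs {a : ℕ} (h : 0 < a) (p : ℕ) :
    dv a * chs 0 (a + 1) p = chs 0 a p - sw a (chs 0 a p) := by
  obtain ⟨c, rfl⟩ : ∃ c, a = c + 1 := ⟨a - 1, by omega⟩
  induction p with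
  | zero => 
    rw [chs_succ_zero, chs_succ_zero]; split_ifs <;> simp_all
  | succ p ih =>
    rw [chs_succ_succ, chs_succ_succ 0 c p, map_add, map_mul, sw_chs_of_lt (by omega), sw_X,
      zero_add, zero_add, sT_left]
    have : dv (c + 1) = X (c + 1) - X (c + 1 + 1) := rfl
    linear_combination X (c + 1 + 1) * ih + chs 0 (c + 1) p * this

lemma sw_chs {a c : ℕ} (h : 0 < a) (hc : c ≠ a) (p : ℕ) : sw a (chs 0 c p) = chs 0 c p := by
  rcases lt_or_gt_of_ne hc with h1 | h1
  · exact sw_chs_of_lt h1 p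
  obtain ⟨k, rfl⟩ := Nat.exists_eq_add_of_le (Nat.succ_le_of_lt h1)
  induction k generalizing p with
  | zero =>
    have h2 := dv_mul_chs h p
    have h3 := congrArg (sw a) h2
    rw [map_mul, sw_dv, map_sub, sw_sw] at h3
    refine dv_cancel (a := a) ?_
    linear_combination -h2 - h3
  | succ k ih =>
    induction p with
    | zero =>
      rw [show a.succ + (k + 1) = a + k + 1 + 1 by omega, chs_succ_zero]; split_ifs <;> simp
    | succ p ihp =>
      rw [show a.succ + (k + 1) = a.succ + k + 1 by omega] at *
      rw [chs_succ_succ, map_add, map_mul, ih _ (by omega) (by omega), ihp, sw_X,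
        sT_ne (by omega) (by omega)]

lemma ev_chs (l c p : ℕ) : ev (chs l (c + 1) p) = p.choose c := by
  induction p generalizing c with
  | zero => rw [chs_succ_zero]; rcases c with _ | c <;> simp
  | succ p ih =>
    have : ev (X (l + c + 1) : Poly) = 1 := aeval_X _ _
    rw [chs_succ_succ, map_add, map_mul, ih, this, one_mul]
    rcases c with _ | c
    · rw [chs_zero]; simp
    · rw [ih, Nat.choose_succ_succ]; push_cast; ring

lemma chs_small {l c p : ℕ} (h : p + 1 < c) : chs l c p = 0 := by
  induction p generalizing c with
  | zero =>
    obtain ⟨c, rfl⟩ : ∃ k, c = k + 1 := ⟨c - 1, by omega⟩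
    rw [chs_succ_zero, if_neg (by omega)]
  | succ p ih =>
    obtain ⟨c, rfl⟩ : ∃ k, c = k + 1 := ⟨c - 1, by omega⟩
    rw [chs_succ_succ, ih (by omega), ih (by omega)]; simp

lemma chs_diag (l p : ℕ) : chs l (p + 1) p = 1 := by
  induction p with
  | zero => rw [chs_succ_zero, if_pos rfl]
  | succ p ih => rw [chs_succ_succ, ih, chs_small (by omega)]; simp

/-- The flagged Jacobi–Trudi matrix of the staircase, with row flags `c`. -/
noncomputable def flagMat (M : ℕ) (c : ℕ → ℕ) : Matrix (Fin M) (Fin M) Poly :=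
  Matrix.of fun i j => chs 0 (c i) (M - 1 - i + j)

/-- The composition of divided differences spelled by a word. -/
noncomputable def Op (l : List ℕ) : Module.End ℚ Poly := (l.map dd).prod

lemma Op_append (l m : List ℕ) : Op (l ++ m) = Op l * Op m := by simp [Op]

lemma dd_flagMat {M a : ℕ} (ha : 0 < a) {c : ℕ → ℕ} (r : Fin M) (hr : c r = a)
    (hc : ∀ i, i < M → i ≠ r → c i ≠ a) :
    dd a (flagMat M c).det = (flagMat M (Function.update c r (a + 1))).det := by
  refine dv_cancel (a := a) ?_
  rw [dd_spec, AlgHom.map_det]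
  have e1 : (sw a).mapMatrix (flagMat M c)
      = (flagMat M c).updateRow r (fun j => sw a (flagMat M c r j)) := by
    ext1 i j
    by_cases h : i = r
    · subst h; rw [Matrix.updateRow_self]; rfl
    · rw [Matrix.updateRow_ne h]
      exact sw_chs ha (hc i i.2 (fun h' => h (Fin.ext h'))) _
  have e2 : flagMat M (Function.update c r (a + 1))
      = (flagMat M c).updateRow r (fun j => chs 0 (a + 1) (M - 1 - r + j)) := by
    ext1 i j
    by_cases h : i = r
    · subst h; rw [Matrix.updateRow_self]; simp [flagMat]
    · rw [Matrix.updateRow_ne h]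
      have : (i : ℕ) ≠ r := fun h' => h (Fin.ext h')
      simp [flagMat, this]
  rw [e1, e2, ← Matrix.det_updateRow_smul, sub_eq_iff_eq_add]
  conv_lhs => rw [← Matrix.updateRow_eq_self (flagMat M c) r]
  rw [← Matrix.det_updateRow_add]
  congr 2
  funext j
  simp only [Pi.add_apply, Pi.smul_apply, smul_eq_mul]
  rw [dv_mul_chs ha]
  simp [flagMat, hr]

/-- Divided differences with letters in `(lo, hi)` turn the flags `c` into the flags `c'`. -/
def Raises (M lo hi : ℕ) (c c' : ℕ → ℕ) : Prop :=
  ∃ l, Letters lo hi l ∧ l.length + ∑ i ∈ Finset.range M, c i = ∑ i ∈ Finset.range M, c' i ∧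
    Op l (flagMat M c).det = (flagMat M c').det

lemma Raises.refl (M lo hi : ℕ) (c : ℕ → ℕ) : Raises M lo hi c c :=
  ⟨[], fun _ h => by simp at h, by simp, by simp [Op]⟩

lemma Raises.trans {M lo hi : ℕ} {c c' c'' : ℕ → ℕ} (h : Raises M lo hi c c')
    (h' : Raises M lo hi c' c'') : Raises M lo hi c c'' := by
  obtain ⟨l, h1, h2, h3⟩ := h
  obtain ⟨l', h1', h2', h3'⟩ := h'
  refine ⟨l' ++ l, h1'.append h1, by rw [List.length_append]; omega, ?_⟩
  rw [Op_append, Module.End.mul_apply, h3, h3']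

lemma raises_row {M lo hi : ℕ} {c : ℕ → ℕ} {r : ℕ} (hr : r < M) (h1 : lo < c r) (k : ℕ) :
    c r + k ≤ hi → (∀ i, i < M → i ≠ r → c i < c r ∨ c r + k ≤ c i) →
    Raises M lo hi c (Function.update c r (c r + k)) := by
  induction k with
  | zero => intro _ _; rw [add_zero, Function.update_eq_self]; exact Raises.refl _ _ _ _
  | succ k ih =>
    intro h2 h
    refine (ih (by omega) fun i hi hi' => ?_).trans ?_
    · have := h i hi hi'; omega
    · refine ⟨[c r + k], Letters.single (by omega), ?_, ?_⟩
      · have h0 : r ∈ Finset.range M := Finset.mem_range.2 hr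
        rw [Finset.sum_update_of_mem h0, Finset.sum_update_of_mem h0]
        simp; omega
      · have := dd_flagMat (M := M) (a := c r + k) (c := Function.update c r (c r + k)) (by omega)
          ⟨r, hr⟩ (by simp) (fun i hi hi' => by
            simp only at hi'
            rw [Function.update_of_ne hi']
            have := h i hi hi'
            omega)
        simp only [Op, List.map_cons, List.map_nil, List.prod_cons, List.prod_nil, mul_one]
        rw [this, Function.update_idem]
        rfl

lemma raises_all {M lo hi : ℕ} {c c' : ℕ → ℕ} (h0 : ∀ k < M, c k ≤ c' k)
    (h : ∀ k < M, c k < c' k → lo < c k ∧ c' k ≤ hi ∧ (∀ i < k, c i < c k) ∧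
      ∀ i < M, k < i → c' k ≤ c' i) : Raises M lo hi c c' := by
  have key : ∀ j ≤ M, Raises M lo hi c (fun i => if M - j ≤ i then c' i else c i) := by
    intro j
    induction j with
    | zero =>
      intro _
      have e : ∀ i, i < M → (if M - 0 ≤ i then c' i else c i) = c i := fun i hi =>
        if_neg (by omega)
      refine ⟨[], fun _ h => by simp at h, ?_, ?_⟩
      · rw [List.length_nil, zero_add]
        exact Finset.sum_congr rfl fun i hi => (e i (Finset.mem_range.1 hi)).symm
      · have : flagMat M (fun i => if M - 0 ≤ i then c' i else c i) = flagMat M c := by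
          ext1 i j
          simp only [flagMat, Matrix.of_apply]
          rw [e i i.2]
        rw [this]; simp [Op]
    | succ j ih =>
      intro hj
      refine (ih (by omega)).trans ?_
      set g := fun i => if M - j ≤ i then c' i else c i with hg
      obtain ⟨k, hk⟩ : ∃ k, k = M - (j + 1) := ⟨_, rfl⟩
      have hk' : M - j = k + 1 := by omega
      have hgk : g k = c k := if_neg (by omega)
      have e : (fun i => if M - (j + 1) ≤ i then c' i else c i)
          = Function.update g k (g k + (c' k - c k)) := by
        funext i
        rcases lt_trichotomy i k with h1 | rfl | h1
        · rw [Function.update_of_ne (by omega), if_neg (by omega)]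
          exact (if_neg (by omega)).symm
        · have := h0 i (by omega)
          rw [Function.update_self, if_pos (by omega), hgk]; omega
        · rw [Function.update_of_ne (by omega), if_pos (by omega)]
          exact (if_pos (by omega)).symm
      rw [e]
      have hkc := h0 k (by omega)
      rcases eq_or_lt_of_le hkc with h1 | h1
      · rw [← h1, Nat.sub_self, add_zero, Function.update_eq_self]; exact Raises.refl _ _ _ _
      · obtain ⟨h2, h3, h4, h5⟩ := h k (by omega) h1
        refine raises_row (by omega) (by omega) _ (by omega) fun i hi hik => ?_
        rcases lt_or_gt_of_ne hik with h6 | h6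
        · have : g i = c i := if_neg (by omega)
          have := h4 i h6
          omega
        · have : g i = c' i := if_pos (by omega)
          have := h5 i hi h6
          omega
  have := key M le_rfl
  simpa using this

/-- The leading monomial of the flagged determinant: the staircase monomial. -/
lemma det_flagMat_stair (M : ℕ) :
    (flagMat M (fun i => i + 1)).det = ∏ i : Fin M, (X (i + 1) : Poly) ^ (M - 1 - i) := by
  have := det_chs M 0 (fun i => M - 1 - i)
  simpa [flagMat] using this

lemma det_flagMat_top (M : ℕ) : (flagMat M (fun _ => M)).det = 1 := by
  rw [Matrix.det_of_isUpperTriangular]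
  · refine Finset.prod_eq_one fun i _ => ?_
    simp only [flagMat, Matrix.of_apply]
    obtain ⟨k, rfl⟩ : ∃ k, M = k + 1 := ⟨M - 1, by have := i.2; omega⟩
    rw [show k + 1 - 1 - (i : ℕ) + i = k by omega, chs_diag]
  · intro i j hij
    simp only [flagMat, Matrix.of_apply]
    have h1 : (j : ℕ) < i := hij
    have := i.2
    exact chs_small (by omega)

/-- The staircase monomial `x_1^{M-1} x_2^{M-2} ⋯`. -/
noncomputable def stairMon (M : ℕ) : Poly := ∏ i : Fin M, (X (i + 1) : Poly) ^ (M - 1 - i)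

/-- The intermediate flags of a dominant-times-long-element permutation. -/
def midFlag (x m : ℕ) (i : ℕ) : ℕ := if i < m then x + i + 1 else m + x

lemma exists_word (x m : ℕ) : ∃ l, Letters 0 (m + x) l ∧
    l.length + ∑ i ∈ Finset.range (m + x), (i + 1) = ∑ i ∈ Finset.range (m + x), midFlag x m i ∧
    Op l (stairMon (m + x)) = (flagMat (m + x) (midFlag x m)).det := by
  have : Raises (m + x) 0 (m + x) (fun i => i + 1) (midFlag x m) := by
    refine raises_all (fun k hk => ?_) fun k hk h => ⟨?_, ?_, ?_, ?_⟩ <;>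
      simp only [midFlag] at * <;> (try intro i) <;> intros <;> (try split_ifs at *) <;> omega
  rw [stairMon, ← det_flagMat_stair]
  exact this

lemma exists_word' (x m : ℕ) : ∃ l, Letters x (m + x) l ∧
    l.length + ∑ i ∈ Finset.range (m + x), midFlag x m i = ∑ _i ∈ Finset.range (m + x), (m + x) ∧
    Op l (flagMat (m + x) (midFlag x m)).det = 1 := by
  have : Raises (m + x) x (m + x) (midFlag x m) (fun _ => m + x) := by
    refine raises_all (fun k hk => ?_) fun k hk h => ⟨?_, ?_, ?_, ?_⟩ <;>
      simp only [midFlag] at * <;> (try intro i) <;> intros <;> (try split_ifs at *) <;> omega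
  rw [← det_flagMat_top]
  exact this

lemma sum_midFlag (x m : ℕ) :
    ∑ i ∈ Finset.range (m + x), midFlag x m i + m.choose 2 = (m + x) * (m + x) := by
  have h1 : ∑ i ∈ Finset.range x, midFlag x m (m + i) = x * (m + x) := by
    have : ∀ i, midFlag x m (m + i) = m + x := fun i => by rw [midFlag, if_neg (by omega)]
    simp [this]
  have h2 : ∑ i ∈ Finset.range m, midFlag x m i = ∑ i ∈ Finset.range m, (x + (i + 1)) :=
    Finset.sum_congr rfl fun i hi => by
      rw [midFlag, if_pos (Finset.mem_range.1 hi)]; ring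
  have h3 : ∀ m, ∑ i ∈ Finset.range m, (i + 1) + m.choose 2 = m * m := by
    intro m
    induction m with
    | zero => simp
    | succ m ih =>
      rw [Finset.sum_range_succ, Nat.choose_succ_succ' m 1, Nat.choose_one_right]
      linarith
  rw [Finset.sum_range_add, h1, h2, Finset.sum_add_distrib]
  have := h3 m
  simp only [Finset.sum_const, Finset.card_range, smul_eq_mul]
  linarith

end LimitShape

namespace LimitShape

open MvPolynomial

lemma prod_swap_range (s c k : ℕ) (hk : 2 * k ≤ c) (p : ℕ) :
    ((List.range k).map fun i => Equiv.swap (s + i + 1) (s + c - i)).prod p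
      = if (s < p ∧ p ≤ s + k) ∨ (s + c < p + k ∧ p ≤ s + c) then 2 * s + c + 1 - p else p := by
  induction k generalizing p with
  | zero => rw [if_neg (by omega)]; simp
  | succ k ih =>
    rw [List.range_succ, List.map_append, List.prod_append, Equiv.Perm.mul_apply]
    simp only [List.map_cons, List.map_nil, List.prod_cons, List.prod_nil, mul_one]
    rw [ih (by omega), Equiv.swap_apply_def]
    split_ifs <;> omega

lemma blockRev_apply (s c p : ℕ) :
    blockRev s c p = if s < p ∧ p ≤ s + c then 2 * s + c + 1 - p else p := by
  rw [blockRev, prod_swap_range s c (c / 2) (by omega)]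
  split_ifs <;> omega

lemma blockRev_supp (s c : ℕ) : Supp s (s + c) (blockRev s c) := fun p hp => by
  rw [blockRev_apply, if_neg hp]

lemma card_block_pairs (s c : ℕ) :
    ((Finset.Ioc s (s + c) ×ˢ Finset.Ioc s (s + c)).filter (fun p => p.1 < p.2)).card
      = c.choose 2 := by
  have : ((Finset.range c).sigma fun j => Finset.range j).card = c.choose 2 := by
    rw [Finset.card_sigma, Nat.choose_two_right, ← Finset.sum_range_id]; simp
  rw [← this]
  refine Finset.card_nbij' (fun p => ⟨p.2 - s - 1, p.1 - s - 1⟩) (fun q => (s + q.2 + 1, s + q.1 + 1))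
    ?_ ?_ ?_ ?_
  · rintro ⟨p, q⟩ h
    simp only [Finset.coe_filter, Finset.mem_product, Finset.mem_Ioc, Set.mem_ofPred_eq] at h
    simp only [Finset.coe_sigma, Set.mem_sigma_iff, Finset.mem_coe, Finset.mem_range]
    omega
  · rintro ⟨p, q⟩ h
    simp only [Finset.coe_sigma, Set.mem_sigma_iff, Finset.mem_coe, Finset.mem_range] at h
    simp only [Finset.coe_filter, Finset.mem_product, Finset.mem_Ioc, Set.mem_ofPred_eq]
    omega
  · rintro ⟨p, q⟩ h
    simp only [Finset.coe_filter, Finset.mem_product, Finset.mem_Ioc, Set.mem_ofPred_eq] at h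
    simp only [Prod.mk.injEq]
    omega
  · rintro ⟨p, q⟩ _
    simp only [Sigma.mk.injEq, heq_eq_eq]
    omega

lemma inv_subset_block {s c n : ℕ} {w : Equiv.Perm ℕ} (hw : Supp s (s + c) w) :
    ((Finset.Icc 1 n ×ˢ Finset.Icc 1 n).filter (fun p => p.1 < p.2 ∧ w p.2 < w p.1))
      ⊆ (Finset.Ioc s (s + c) ×ˢ Finset.Ioc s (s + c)).filter (fun p => p.1 < p.2) := by
  rintro ⟨p, q⟩ h
  simp only [Finset.mem_filter, Finset.mem_product, Finset.mem_Ioc, Finset.mem_Icc] at h ⊢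
  have hp := hw p
  have hp' := @Supp.mem _ _ _ hw p
  have hq := hw q
  have hq' := @Supp.mem _ _ _ hw q
  by_cases h1 : s < p ∧ p ≤ s + c <;> by_cases h2 : s < q ∧ q ≤ s + c <;>
    simp only [h1, h2, not_true, not_false_eq_true, true_implies, and_self, false_implies] at hp hq hp' hq' <;>
    omega

lemma len_blockRev {s c n : ℕ} (h : s + c ≤ n) : len n (blockRev s c) = c.choose 2 := by
  rw [← card_block_pairs s c, len]
  congr 1
  refine (inv_subset_block (blockRev_supp s c)).antisymm ?_
  rintro ⟨p, q⟩ h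
  simp only [Finset.mem_filter, Finset.mem_product, Finset.mem_Ioc, Finset.mem_Icc] at h ⊢
  rw [blockRev_apply, blockRev_apply, if_pos (by omega), if_pos (by omega)]
  omega

lemma eq_blockRev {s c n : ℕ} {w : Equiv.Perm ℕ} (hw : Supp s (s + c) w)
    (hl : len n w = c.choose 2) : w = blockRev s c := by
  rw [← card_block_pairs s c, len] at hl
  have he := Finset.eq_of_subset_of_card_le (inv_subset_block hw) hl.ge
  have hd : ∀ p q, s < p → p < q → q ≤ s + c → w q < w p := fun p q h1 h2 h3 => by
    have : (p, q) ∈ (Finset.Ioc s (s + c) ×ˢ Finset.Ioc s (s + c)).filter (fun p => p.1 < p.2) := by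
      simp only [Finset.mem_filter, Finset.mem_product, Finset.mem_Ioc]; omega
    rw [← he] at this
    exact (Finset.mem_filter.1 this).2.2
  have hup : ∀ i, i < c → w (s + 1 + i) + i ≤ s + c := fun i => by
    induction i with
    | zero => intro hi; exact (hw.mem (p := s + 1) (by omega)).2
    | succ i ih =>
      intro hi
      have := hd (s + 1 + i) (s + 1 + (i + 1)) (by omega) (by omega) (by omega)
      have := ih (by omega)
      omega
  have hlo : ∀ i, i < c → s + 1 + i ≤ w (s + c - i) := fun i => by
    induction i with
    | zero => intro hi; exact (hw.mem (p := s + c) (by omega)).1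
    | succ i ih =>
      intro hi
      have := hd (s + c - (i + 1)) (s + c - i) (by omega) (by omega) (by omega)
      have := ih (by omega)
      omega
  ext p
  rw [blockRev_apply]
  split_ifs with hp
  · have h1 := hup (p - s - 1) (by omega)
    have h2 := hlo (s + c - p) (by omega)
    rw [show s + 1 + (p - s - 1) = p by omega] at h1
    rw [show s + c - (s + c - p) = p by omega] at h2
    omega
  · exact hw p hp

lemma Red.of_append {n : ℕ} {l m : List ℕ} (h : Red n (l ++ m)) : Red n l := by
  induction m using List.reverseRecOn with
  | nil => simpa using h
  | append_singleton m a ih => exact ih (Red.init (by rwa [List.append_assoc])).1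

open scoped Classical in
/-- The weighted count of words of length `d` with product `w`. -/
noncomputable def eW (n : ℕ) : ℕ → Equiv.Perm ℕ → ℚ
  | 0, w => if w = 1 then 1 else 0
  | d + 1, w => ∑ a ∈ Finset.Ico 1 n, (a : ℚ) * eW n d (w * sT a)

open scoped Classical in
lemma sum_words (n d : ℕ) (w : Equiv.Perm ℕ) :
    ∑ a ∈ Finset.univ.filter (fun a : Fin d → Fin n =>
        (∀ i, 1 ≤ (a i : ℕ)) ∧ (List.ofFn fun i => sT ((a i : ℕ))).prod = w),
      ∏ i, ((a i : ℕ) : ℚ) = eW n d w := by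
  induction d generalizing w with
  | zero =>
    rw [eW]
    by_cases h : w = 1
    · simp [h]
    · have h' : ¬ 1 = w := fun e => h e.symm
      simp [h, h']
  | succ d ih =>
    rw [eW, Finset.sum_filter, ← (Fin.snocEquiv fun _ => Fin n).sum_comp, Fintype.sum_prod_type]
    have e1 : Finset.Ico 1 n = (Finset.range n).filter (fun a => 1 ≤ a) := by
      ext a; simp only [Finset.mem_Ico, Finset.mem_filter, Finset.mem_range]; omega
    rw [e1, Finset.sum_filter, Finset.sum_range]
    refine Finset.sum_congr rfl fun b _ => ?_
    rw [← ih, Finset.sum_filter]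
    split_ifs with hb
    · rw [Finset.mul_sum]
      refine Finset.sum_congr rfl fun a _ => ?_
      have : ∀ z : Equiv.Perm ℕ, z * sT b = w ↔ z = w * sT b := fun z =>
        ⟨fun h => by rw [← h, mul_assoc, sT_mul_self, mul_one],
          fun h => by rw [h, mul_assoc, sT_mul_self, mul_one]⟩
      simp only [Fin.snocEquiv, Equiv.coe_fn_mk, Fin.forall_fin_succ', Fin.snoc_castSucc,
        Fin.snoc_last, hb, and_true, List.ofFn_succ', List.concat_eq_append, List.prod_append,
        List.prod_singleton, this, Fin.prod_univ_castSucc]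
      split_ifs <;> ring
    · refine Finset.sum_eq_zero fun a _ => if_neg ?_
      rintro ⟨h, -⟩
      exact hb (by simpa [Fin.snocEquiv] using h (Fin.last d))

lemma Upsilon_eq (n : ℕ) (w : Equiv.Perm ℕ) :
    Upsilon n w = ((len n w).factorial : ℚ)⁻¹ * eW n (len n w) w := by
  rw [Upsilon, sum_words]

lemma hom_X (i : ℕ) : Hom 1 (X i) := by rw [Hom, eul_X]; simp

lemma hom_one : Hom 0 1 := by rw [Hom]; simp

lemma Hom.mul {d e : ℕ} {g h : Poly} (hg : Hom d g) (hh : Hom e h) : Hom (d + e) (g * h) := by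
  rw [Hom] at *
  rw [Derivation.leibniz, hg, hh]
  simp only [smul_eq_mul, MvPolynomial.smul_eq_C_mul, Nat.cast_add, map_add]
  ring

lemma Hom.pow {d : ℕ} {g : Poly} (hg : Hom d g) (k : ℕ) : Hom (k * d) (g ^ k) := by
  induction k with
  | zero => simpa using hom_one
  | succ k ih => rw [pow_succ, Nat.succ_mul]; exact ih.mul hg

lemma Hom.prod {ι : Type*} (s : Finset ι) (F : ι → Poly) (e : ι → ℕ) (h : ∀ i ∈ s, Hom (e i) (F i)) :
    Hom (∑ i ∈ s, e i) (∏ i ∈ s, F i) := by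
  classical
  induction s using Finset.induction_on with
  | empty => simpa using hom_one
  | insert a s ha ih =>
    rw [Finset.sum_insert ha, Finset.prod_insert ha]
    exact (h a (by simp)).mul (ih fun i hi => h i (by simp [hi]))

lemma hom_stairMon (M : ℕ) : Hom (M.choose 2) (stairMon M) := by
  have : M.choose 2 = ∑ i : Fin M, (M - 1 - i) := by
    rw [← Finset.sum_range (fun i => M - 1 - i), Finset.sum_range_reflect (fun i => i),
      Finset.sum_range_id, Nat.choose_two_right]
  rw [this, stairMon]
  refine Hom.prod _ _ _ fun i _ => ?_
  simpa using (hom_X (i + 1)).pow (M - 1 - i)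

lemma stair_stairMon (M : ℕ) : Stair M (stairMon M) := fun i => by
  refine (degreeOf_prod_le i _ _).trans ?_
  have h : ∀ j : Fin M, degreeOf i ((X (j + 1) : Poly) ^ (M - 1 - j))
      ≤ if (j : ℕ) + 1 = i then M - i else 0 := fun j => by
    refine (degreeOf_pow_le _ _ _).trans ?_
    rw [degreeOf_X]
    split_ifs <;> omega
  refine (Finset.sum_le_sum fun j _ => h j).trans ?_
  rw [← Finset.sum_range (fun j => if j + 1 = i then M - i else 0)]
  rcases i with _ | i
  · simp
  · simp only [Nat.add_right_cancel_iff, Finset.sum_ite_eq', Finset.mem_range]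
    rw [if_neg i.succ_ne_zero]
    split_ifs <;> omega

lemma hom_Op {l : List ℕ} : ∀ {d : ℕ} {g : Poly}, Hom (l.length + d) g → Hom d (Op l g) := by
  induction l using List.reverseRecOn with
  | nil => intro d g h; simpa [Op] using h
  | append_singleton l a ih =>
    intro d g h
    rw [Op_append]
    refine ih (Hom.dd (a := a) ?_) |> fun h => by simpa [Op] using h
    rwa [List.length_append, List.length_singleton,
      show l.length + 1 + d = l.length + d + 1 by ring] at h

lemma stair_Op {M : ℕ} {l : List ℕ} (hl : Letters 0 M l) {g : Poly} (hg : Stair M g) :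
    Stair M (Op l g) := by
  induction l with
  | nil => simpa [Op] using hg
  | cons a l ih =>
    have ha := hl a (by simp)
    have := (ih fun b hb => hl b (by simp [hb])).dd ha.1 ha.2
    simpa [Op] using this

lemma Op_eq_zero {n : ℕ} {l : List ℕ} (hl : Letters 0 n l) (hr : ¬ Red n l) : Op l = 0 :=
  nil_word dd dd_comm dd_braid dd_dd hl hr

lemma Op_eq_of_red {n : ℕ} {l l' : List ℕ} (hl : Red n l) (hl' : Red n l')
    (h : wordProd l = wordProd l') : Op l = Op l' :=
  matsumoto dd dd_comm dd_braid hl hl' h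

/-- There is a word `β ++ ν` for the long element whose tail produces the determinant polynomial. -/
lemma exists_factor (x m : ℕ) : ∃ β ν : List ℕ, Letters x (m + x) β ∧ Letters 0 (m + x) ν ∧
    β.length = m.choose 2 ∧ β.length + ν.length = (m + x).choose 2 ∧
    Op ν (stairMon (m + x)) = (flagMat (m + x) (midFlag x m)).det ∧
    Op (β ++ ν) (stairMon (m + x)) = 1 := by
  obtain ⟨ν, hν, lν, eν⟩ := exists_word x m
  obtain ⟨β, hβ, lβ, eβ⟩ := exists_word' x m
  have h1 := sum_midFlag x m
  have h2 := sum_midFlag 0 (m + x)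
  have h3 : ∑ i ∈ Finset.range (m + x), midFlag 0 (m + x) i
      = ∑ i ∈ Finset.range (m + x), (i + 1) :=
    Finset.sum_congr rfl fun i hi => by
      rw [midFlag, if_pos (Finset.mem_range.1 hi)]; ring
  have h4 : ∑ i ∈ Finset.range (m + x), (m + x) = (m + x) * (m + x) := by simp
  simp only [add_zero] at h2
  refine ⟨β, ν, hβ, hν, by omega, by omega, eν, ?_⟩
  rw [Op_append, Module.End.mul_apply, eν, eβ]

open scoped Classical in
lemma Op_top {M : ℕ} {l : List ℕ} (hl : Letters 0 M l) (hlen : l.length = M.choose 2) :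
    Op l (stairMon M) = if wordProd l = blockRev 0 M then 1 else 0 := by
  obtain ⟨β, ν, hβ, hν, -, hlen', -, h1⟩ := exists_factor 0 M
  rw [add_zero] at hlen' h1 hβ hν
  have hW : Red M (β ++ ν) := by
    by_contra hr
    rw [Op_eq_zero (hβ.append hν) hr] at h1
    exact zero_ne_one h1
  have hkey : ∀ {w}, Red M w → w.length = M.choose 2 → wordProd w = blockRev 0 M := fun {w} hw hwl =>
    eq_blockRev (n := M) (by simpa using hw.1.supp) (by rw [hw.2, hwl])
  by_cases hr : Red M l
  · rw [if_pos (hkey hr hlen), Op_eq_of_red hr hW, h1]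
    rw [hkey hr hlen, hkey hW (by rw [List.length_append, hlen'])]
  · rw [Op_eq_zero hl hr, if_neg]; · rfl
    intro he
    exact hr ⟨hl, by rw [he, len_blockRev (by omega), hlen]⟩

lemma bigD_pow_Op {M : ℕ} (d : ℕ) : ∀ {ν : List ℕ}, Letters 0 M ν → ν.length + d = M.choose 2 →
    (bigD M ^ d) (Op ν (stairMon M)) = C (eW M d (blockRev 0 M * (wordProd ν)⁻¹)) := by
  induction d with
  | zero =>
    intro ν hν hl
    rw [pow_zero, Module.End.one_apply, Op_top hν (by omega), eW]
    by_cases h : wordProd ν = blockRev 0 M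
    · rw [if_pos h, h, if_pos (mul_inv_cancel _), C_1]
    · rw [if_neg h, if_neg fun e => h (mul_inv_eq_one.1 e).symm, C_0]
  | succ d ih =>
    intro ν hν hl
    rw [pow_succ, Module.End.mul_apply, bigD_apply, map_sum, eW, map_sum]
    refine Finset.sum_congr rfl fun a ha => ?_
    have ha' := Finset.mem_Ico.1 ha
    have := ih (ν := a :: ν) (by
      intro b hb
      rcases List.mem_cons.1 hb with rfl | hb
      · omega
      · exact hν b hb) (by simp; omega)
    have e : (sT a)⁻¹ = sT a := inv_eq_of_mul_eq_one_left (sT_mul_self a)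
    simp only [Op, wordProd, List.map_cons, List.prod_cons, Module.End.mul_apply, mul_inv_rev,
      e, ← mul_assoc] at this
    rw [map_smul, Op, this, wordProd, MvPolynomial.smul_eq_C_mul, ← map_mul]

/-- The principal specialization at a reversed block is the specialization of a flagged determinant. -/
theorem Upsilon_blockRev (x m : ℕ) :
    Upsilon (m + x) (blockRev x m) = ev (flagMat (m + x) (midFlag x m)).det := by
  obtain ⟨β, ν, hβ, hν, lβ, hl, e1, e2⟩ := exists_factor x m
  have hβ0 : Letters 0 (m + x) β := hβ.mono (by omega) le_rfl
  have hW : Red (m + x) (β ++ ν) := by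
    by_contra hr
    rw [Op_eq_zero (hβ0.append hν) hr] at e2
    exact zero_ne_one e2
  have hb : wordProd β = blockRev x m :=
    eq_blockRev (n := m + x) (by rw [add_comm]; exact hβ.supp)
      (by rw [(Red.of_append hW).2, lβ])
  have hw : wordProd (β ++ ν) = blockRev 0 (m + x) :=
    eq_blockRev (n := m + x) (by simpa using hW.1.supp)
      (by rw [hW.2, List.length_append, hl])
  have hD := bigD_pow_Op (m.choose 2) hν (by omega)
  rw [← hw, wordProd_append, mul_inv_cancel_right, hb] at hD
  have hm := macdonald (M := m + x) (d := m.choose 2) (g := Op ν (stairMon (m + x)))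
    (hom_Op (by rw [show ν.length + m.choose 2 = (m + x).choose 2 by omega]; exact hom_stairMon _))
    (stair_Op hν (stair_stairMon _))
  rw [hD] at hm
  have hm' := C_injective _ _ hm
  rw [Upsilon_eq, len_blockRev (by omega), hm', e1, inv_mul_cancel_left₀]
  exact_mod_cast Nat.factorial_ne_zero _

end LimitShape

namespace LimitShape

open MvPolynomial

/-- The monic polynomial in `T = t (t + 1)` representing `(2k)! * (t + k).choose (2k)`. -/
noncomputable def oddPoly (k : ℕ) : Polynomial ℚ :=
  ∏ j ∈ Finset.range k, (Polynomial.X - Polynomial.C ((j : ℚ) * (j + 1)))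

lemma oddPoly_monic (k : ℕ) : (oddPoly k).Monic :=
  Polynomial.monic_prod_of_monic _ _ fun _ _ => Polynomial.monic_X_sub_C _

lemma oddPoly_natDegree (k : ℕ) : (oddPoly k).natDegree = k := by
  rw [oddPoly, Polynomial.natDegree_prod_of_monic _ _ fun _ _ => Polynomial.monic_X_sub_C _,
    Finset.sum_congr rfl fun _ _ => Polynomial.natDegree_X_sub_C _]
  simp

lemma oddPoly_eval (k t : ℕ) :
    (oddPoly k).eval ((t : ℚ) * (t + 1)) = (2 * k).factorial * (t + k).choose (2 * k) := by
  have h : (oddPoly k).eval ((t : ℚ) * (t + 1)) = ((t + k).descFactorial (2 * k) : ℕ) := by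
    induction k with
    | zero => simp [oddPoly]
    | succ k ih =>
      have e : oddPoly (k + 1) = oddPoly k * (Polynomial.X - Polynomial.C ((k : ℚ) * (k + 1))) :=
        Finset.prod_range_succ _ _
      rw [e, Polynomial.eval_mul, ih, show t + (k + 1) = (t + k) + 1 by ring,
        show 2 * (k + 1) = (2 * k + 1) + 1 by ring, Nat.succ_descFactorial_succ,
        Nat.descFactorial_succ]
      simp only [Polynomial.eval_sub, Polynomial.eval_X, Polynomial.eval_C]
      rcases lt_or_ge t k with h | h
      · rw [Nat.descFactorial_eq_zero_iff_lt.2 (by omega)]; simp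
      · obtain ⟨r, rfl⟩ := Nat.exists_eq_add_of_le h
        rw [show k + r + k - 2 * k = r by omega]
        push_cast; ring
  rw [h, Nat.descFactorial_eq_factorial_mul_choose]; push_cast; ring

lemma alternating_choose (q : ℕ) : ∀ r N : ℕ,
    ∑ t ∈ Finset.range (r + 1), (-1 : ℚ) ^ (r - t) * r.choose t * (N + t).choose q
      = if r ≤ q then (N.choose (q - r) : ℚ) else 0 := by
  have key : ∀ r, (fwdDiff (1 : ℕ))^[r] (fun N => ((N.choose q : ℕ) : ℚ))
      = fun N => if r ≤ q then ((N.choose (q - r) : ℕ) : ℚ) else 0 := by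
    intro r
    induction r with
    | zero => simp
    | succ r ih =>
      rw [Function.iterate_succ_apply', ih]
      funext N
      rw [fwdDiff]
      rcases lt_trichotomy r q with h | h | h
      · rw [if_pos (by omega), if_pos (by omega), if_pos (by omega),
          show q - r = (q - (r + 1)) + 1 by omega, Nat.choose_succ_succ]
        push_cast; ring
      · subst h; simp
      · rw [if_neg (by omega), if_neg (by omega), if_neg (by omega)]; simp
  intro r N
  have := congrFun (key r) N
  rw [fwdDiff_iter_eq_sum_shift] at this
  rw [← this]
  refine Finset.sum_congr rfl fun t _ => ?_
  simp [zsmul_eq_mul]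

/-- The specialized flagged matrix restricted to the nontrivial rows. -/
def binMat (x m : ℕ) : Matrix (Fin m) (Fin m) ℚ :=
  Matrix.of fun i j => ((x + (m - 1 - i) + j).choose (x + i) : ℚ)

lemma ev_det_flagMat (x m : ℕ) : ev (flagMat (m + x) (midFlag x m)).det = (binMat x m).det := by
  set A : Matrix (Fin (m + x)) (Fin (m + x)) ℚ :=
    Matrix.of fun i j => ((m + x - 1 - i + j).choose (midFlag x m i - 1) : ℚ) with hA
  have h1 : ev (flagMat (m + x) (midFlag x m)).det = A.det := by
    rw [AlgHom.map_det]
    congr 1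
    ext i j
    have : midFlag x m i = midFlag x m i - 1 + 1 := by
      have := i.2
      rw [midFlag]; split_ifs <;> omega
    simp only [AlgHom.mapMatrix_apply, Matrix.map_apply, flagMat, Matrix.of_apply, hA]
    rw [this, ev_chs]; rfl
  rw [h1, ← Matrix.det_submatrix_equiv_self finSumFinEquiv A]
  have h2 : A.submatrix finSumFinEquiv finSumFinEquiv = Matrix.fromBlocks (binMat x m)
      (Matrix.of fun (i : Fin m) (j : Fin x) => A (Fin.castAdd x i) (Fin.natAdd m j)) 0
      (Matrix.of fun (i : Fin x) (j : Fin x) => A (Fin.natAdd m i) (Fin.natAdd m j)) := by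
    ext i j
    rcases i with i | i <;> rcases j with j | j
    · have := i.2
      simp only [Matrix.submatrix_apply, finSumFinEquiv_apply_left, hA, Matrix.of_apply,
        Fin.val_castAdd, midFlag, i.2, if_true, Matrix.fromBlocks_apply₁₁, binMat]
      congr 2; omega
    · simp
    · have := i.2
      have := j.2
      simp only [Matrix.submatrix_apply, finSumFinEquiv_apply_left, finSumFinEquiv_apply_right, hA,
        Matrix.of_apply, Fin.val_castAdd, Fin.val_natAdd, midFlag, Matrix.fromBlocks_apply₂₁,
        Matrix.zero_apply]
      rw [if_neg (by omega), Nat.choose_eq_zero_of_lt (by omega)]; rfl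
    · simp
  rw [h2, Matrix.det_fromBlocks_zero₂₁, Matrix.det_of_isUpperTriangular (M := Matrix.of _),
    Finset.prod_eq_one, mul_one]
  · intro i _
    have := i.2
    simp only [hA, Matrix.of_apply, Fin.val_natAdd, midFlag]
    rw [if_neg (by omega), show m + x - 1 - (m + i) + (m + i) = m + x - 1 by omega]
    simp
  · intro i j hij
    have hij' : j < i := hij
    have := i.2
    simp only [hA, Matrix.of_apply, Fin.val_natAdd, midFlag]
    rw [if_neg (by omega), Nat.choose_eq_zero_of_lt (by omega)]; rfl

lemma exists_det_binMat (m : ℕ) : ∃ κ : ℚ, ∀ x : ℕ, (binMat x m).det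
    = κ * ∏ l : Fin m, ∏ l' ∈ Finset.Ioi l,
      (((x + l' : ℕ) : ℚ) * ((x + l' : ℕ) + 1) - ((x + l : ℕ) : ℚ) * ((x + l : ℕ) + 1)) := by
  set U : Matrix (Fin m) (Fin m) ℚ := Matrix.of fun j l =>
    if l ≤ j then (-1 : ℚ) ^ (m - 1 - l - (j - l)) * (m - 1 - l).choose (j - l) else 0 with hU
  have hdU : U.det ≠ 0 := by
    rw [Matrix.det_of_isLowerTriangular, Finset.prod_ne_zero_iff]
    · intro i _
      simp [hU]
    · intro i j hij
      have hij' : i < j := hij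
      simp [hU, hij']
  refine ⟨(U.det)⁻¹ * ((∏ i : Fin m, ((2 * (m - 1 - i)).factorial : ℚ)⁻¹) *
    (Equiv.Perm.sign (Fin.revPerm : Equiv.Perm (Fin m)) : ℤ)), fun x => ?_⟩
  set w : Fin m → ℚ := fun l => ((x + l : ℕ) : ℚ) * ((x + l : ℕ) + 1) with hw
  have h1 : binMat x m * U = Matrix.of fun i l : Fin m =>
      (((2 * (m - 1 - i)).factorial : ℚ)⁻¹) *
        ((Matrix.of fun a b : Fin m => (oddPoly b).eval (w a)).transpose.submatrix Fin.revPerm id) i l := by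
    ext i l
    have hi := i.2
    have hl := l.2
    simp only [Matrix.mul_apply, Matrix.of_apply, Matrix.submatrix_apply, Matrix.transpose_apply,
      Fin.revPerm_apply, id, hw]
    have hrev : (Fin.rev i : ℕ) = m - 1 - i := by rw [Fin.val_rev]; omega
    rw [hrev, oddPoly_eval, inv_mul_cancel_left₀ (by exact_mod_cast Nat.factorial_ne_zero _)]
    have hs := alternating_choose (x + i) (m - 1 - l) (x + (m - 1 - i) + l)
    have hr : (if m - 1 - l ≤ x + i then
        ((x + (m - 1 - i) + l).choose (x + i - (m - 1 - l)) : ℚ) else 0)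
        = ((x + l + (m - 1 - i)).choose (2 * (m - 1 - i)) : ℕ) := by
      split_ifs with h
      · rw [← Nat.choose_symm (by omega)]
        congr 2 <;> omega
      · rw [Nat.choose_eq_zero_of_lt (by omega)]; simp
    rw [← hr, ← hs, show m - 1 - (l : ℕ) + 1 = m - l by omega]
    simp only [binMat, hU, Matrix.of_apply, Fin.le_def]
    have e : Finset.range m = Finset.range (l + (m - l)) := by congr 1; omega
    rw [← Finset.sum_range (fun j => ((x + (m - 1 - i) + j).choose (x + i) : ℚ) *
      (if (l : ℕ) ≤ j then (-1 : ℚ) ^ (m - 1 - l - (j - l)) * (m - 1 - l).choose (j - l) else 0))]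
    rw [e, Finset.sum_range_add, Finset.sum_eq_zero, zero_add]
    · refine Finset.sum_congr rfl fun t _ => ?_
      rw [if_pos (by omega), Nat.add_sub_cancel_left, ← add_assoc]
      ring
    · intro j hj
      rw [if_neg (by rw [Finset.mem_range] at hj; omega), mul_zero]
  have h2 := congrArg Matrix.det h1
  rw [Matrix.det_mul, Matrix.det_mul_column, Matrix.det_permute, Matrix.det_transpose,
    ← Matrix.det_eval_matrixOfPolynomials_eq_det_vandermonde _ _ (fun i => oddPoly_natDegree i)
      (fun i => oddPoly_monic i), Matrix.det_vandermonde] at h2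
  rw [mul_assoc, mul_assoc, ← h2, mul_comm (binMat x m).det, inv_mul_cancel_left₀ hdU]

/-- The principal specialization of a reversed block. -/
theorem Upsilon_blockRev_eq (x m : ℕ) : Upsilon (m + x) (blockRev x m) =
    ∏ l : Fin m, ∏ l' ∈ Finset.Ioi l, ((2 * x + (l : ℕ) + (l' : ℕ) + 1 : ℚ) / ((l : ℕ) + (l' : ℕ) + 1)) := by
  obtain ⟨κ, hκ⟩ := exists_det_binMat m
  have h0 : (binMat 0 m).det = 1 := by
    rw [← ev_det_flagMat]
    have : flagMat (m + 0) (midFlag 0 m) = flagMat m (fun i => i + 1) := by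
      ext i j
      have : (i : ℕ) < m := i.2
      simp only [flagMat, Matrix.of_apply, midFlag, this, if_true]
      rw [zero_add]; rfl
    rw [this, det_flagMat_stair]
    simp [ev]
  rw [Upsilon_blockRev, ev_det_flagMat]
  have e1 := hκ 0
  have e2 := hκ x
  rw [h0] at e1
  rw [e2]
  set P : ℕ → ℚ := fun x => ∏ l : Fin m, ∏ l' ∈ Finset.Ioi l,
      (((x + l' : ℕ) : ℚ) * ((x + l' : ℕ) + 1) - ((x + l : ℕ) : ℚ) * ((x + l : ℕ) + 1)) with hP
  have hP0 : P 0 ≠ 0 := fun h => by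
    have : (1 : ℚ) = κ * P 0 := e1
    rw [h, mul_zero] at this
    exact one_ne_zero this
  have hk : κ = (P 0)⁻¹ := by
    exact eq_inv_of_mul_eq_one_left e1.symm
  change κ * P x = _
  rw [hk, mul_comm, ← div_eq_mul_inv, hP]
  simp only [← Finset.prod_div_distrib]
  refine Finset.prod_congr rfl fun l _ => Finset.prod_congr rfl fun l' hl' => ?_
  have hll : (l : ℕ) < l' := Fin.lt_def.1 (Finset.mem_Ioi.1 hl')
  have hll' : ((l' : ℕ) : ℚ) - (l : ℕ) ≠ 0 := sub_ne_zero.2 (by exact_mod_cast hll.ne')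
  have hpos : ((l : ℕ) + (l' : ℕ) + 1 : ℚ) ≠ 0 := by positivity
  push_cast
  rw [div_eq_div_iff _ hpos]
  · ring
  · have : ((0 : ℚ) + l') * (0 + l' + 1) - (0 + l) * (0 + l + 1) = (l' - l) * (l + l' + 1) := by ring
    rw [this]
    exact mul_ne_zero hll' hpos

end LimitShape

namespace LimitShape

lemma eW_eq_zero {n d : ℕ} {w : Equiv.Perm ℕ} (h : d < len n w) : eW n d w = 0 := by
  induction d generalizing w with
  | zero =>
    rw [eW, if_neg]
    rintro rfl
    rw [len_one] at h; omega
  | succ d ih =>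
    rw [eW]
    refine Finset.sum_eq_zero fun a ha => ?_
    have ha := Finset.mem_Ico.1 ha
    rw [ih, mul_zero]
    rcases lt_or_gt_perm w a with hd | hd
    · rw [len_mul_sT (by omega) ha.2 hd]; omega
    · rw [len_mul_sT' (by omega) ha.2 hd] at h; omega

lemma Upsilon_rec (n : ℕ) (w : Equiv.Perm ℕ) : (len n w : ℚ) * Upsilon n w =
    ∑ a ∈ Finset.Ico 1 n, if w (a + 1) < w a then (a : ℚ) * Upsilon n (w * sT a) else 0 := by
  rcases hd : len n w with _ | d
  · rw [Nat.cast_zero, zero_mul, Finset.sum_eq_zero]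
    intro a ha
    have ha := Finset.mem_Ico.1 ha
    rw [if_neg]
    intro h
    have := len_mul_sT' (by omega) ha.2 h
    omega
  · have hf : ((d + 1 : ℕ) : ℚ) * (((d + 1).factorial : ℚ)⁻¹) = ((d.factorial : ℚ))⁻¹ := by
      rw [Nat.factorial_succ]; push_cast; field_simp
    rw [Upsilon_eq, hd, ← mul_assoc, hf, eW, Finset.mul_sum]
    refine Finset.sum_congr rfl fun a ha => ?_
    have ha := Finset.mem_Ico.1 ha
    split_ifs with h
    · have := len_mul_sT' (by omega) ha.2 h
      have e : len n (w * sT a) = d := by omega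
      rw [Upsilon_eq, e]; ring
    · rw [eW_eq_zero, mul_zero, mul_zero]
      rw [len_mul_sT (by omega) ha.2 ((lt_or_gt_perm w a).resolve_right h)]; omega

lemma Upsilon_one (n : ℕ) : Upsilon n 1 = 1 := by
  rw [Upsilon_eq, len_one, eW]; simp

lemma eq_one_of_len_eq_zero {n : ℕ} {w : Equiv.Perm ℕ} (hw : Supp 0 n w) (h : len n w = 0) :
    w = 1 := by
  by_contra hne
  obtain ⟨a, h1, h2, h3⟩ := exists_descent hw hne
  have := len_mul_sT' h1 h2 h3
  omega

lemma len_mul {k n : ℕ} {u z : Equiv.Perm ℕ} (hu : Supp 0 k u) (hz : Supp k n z) :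
    len n (u * z) = len n u + len n z := by
  have key : ∀ p, (p ≤ k → z p = p ∧ u p ≤ k) ∧ (k < p → u p = p ∧ u (z p) = z p ∧ k < z p) := by
    intro p
    refine ⟨fun h => ⟨hz p (by omega), ?_⟩, fun h => ⟨hu p (by omega), ?_⟩⟩
    · rcases Nat.eq_zero_or_pos p with rfl | hp
      · rw [hu 0 (by omega)]; omega
      · exact (hu.mem (by omega)).2
    · have : k < z p := by
        by_cases hp : p ≤ n
        · exact (hz.mem ⟨h, hp⟩).1
        · rw [hz p (by omega)]; exact h
      exact ⟨hu _ (by omega), this⟩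
  unfold len
  rw [← Finset.card_union_of_disjoint]
  · congr 1
    ext ⟨p, q⟩
    simp only [Finset.mem_filter, Finset.mem_union, Finset.mem_product, Finset.mem_Icc]
    rw [Equiv.Perm.mul_apply, Equiv.Perm.mul_apply]
    have hp := key p
    have hq := key q
    rcases le_or_gt p k with h1 | h1 <;> rcases le_or_gt q k with h2 | h2
    · rw [(hp.1 h1).1, (hq.1 h2).1]
      omega
    · have := hp.1 h1; have := hq.2 h2
      rw [(hp.1 h1).1]; omega
    · omega
    · have := hp.2 h1; have := hq.2 h2
      omega
  · rw [Finset.disjoint_left]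
    rintro ⟨p, q⟩ h h'
    simp only [Finset.mem_filter, Finset.mem_product, Finset.mem_Icc] at h h'
    have hp := key p
    have hq := key q
    rcases le_or_gt p k with h1 | h1 <;> rcases le_or_gt q k with h2 | h2
    · have := hp.1 h1; have := hq.1 h2; omega
    · have := hp.1 h1; have := hq.2 h2; omega
    · omega
    · have := hp.2 h1; have := hq.2 h2; omega

lemma sT_comm_supp_left {k n a : ℕ} {z : Equiv.Perm ℕ} (hz : Supp k n z) (h : a < k) :
    z * sT a = sT a * z := by
  ext p
  simp only [Equiv.Perm.mul_apply]
  by_cases hp : p ≤ k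
  · rw [hz p (by omega), hz]
    rw [sT_apply]; split_ifs <;> omega
  · have : k < z p := by
      by_cases hpn : p ≤ n
      · exact (hz.mem (by omega)).1
      · rw [hz p (by omega)]; omega
    rw [sT_apply, if_neg (by omega), if_neg (by omega), sT_apply, if_neg (by omega),
      if_neg (by omega)]

lemma Upsilon_mul {k n : ℕ} (hk : k ≤ n) (d : ℕ) : ∀ {u z : Equiv.Perm ℕ}, Supp 0 k u →
    Supp k n z → len n u + len n z = d → Upsilon n (u * z) = Upsilon n u * Upsilon n z := by
  induction d with
  | zero =>
    intro u z hu hz h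
    rw [eq_one_of_len_eq_zero (hu.mono le_rfl hk) (by omega),
      eq_one_of_len_eq_zero (hz.mono (Nat.zero_le k) le_rfl) (by omega), mul_one, Upsilon_one, mul_one]
  | succ d ih =>
    intro u z hu hz h
    have hpos : ((d + 1 : ℕ) : ℚ) ≠ 0 := by positivity
    refine mul_left_cancel₀ hpos ?_
    have e1 := Upsilon_rec n (u * z)
    rw [len_mul hu hz, h] at e1
    have e2 : ((d + 1 : ℕ) : ℚ) * (Upsilon n u * Upsilon n z)
        = (len n u * Upsilon n u) * Upsilon n z + Upsilon n u * (len n z * Upsilon n z) := by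
      rw [← h]; push_cast; ring
    rw [e1, e2, Upsilon_rec, Upsilon_rec, Finset.sum_mul, Finset.mul_sum, ← Finset.sum_add_distrib]
    refine Finset.sum_congr rfl fun a ha => ?_
    have ha := Finset.mem_Ico.1 ha
    rcases lt_trichotomy a k with hak | hak | hak
    · have hA : (u * z) a = u a := by rw [Equiv.Perm.mul_apply, hz a (by omega)]
      have hB : (u * z) (a + 1) = u (a + 1) := by rw [Equiv.Perm.mul_apply, hz (a + 1) (by omega)]
      rw [hA, hB, hz a (by omega), hz (a + 1) (by omega), if_neg (show ¬ a + 1 < a by omega)]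
      split_ifs with hd
      · rw [mul_assoc u, sT_comm_supp_left hz hak, ← mul_assoc u,
          ih (hu.mul (Supp.sT (by omega) hak)) hz]
        · ring
        · have := len_mul_sT' (by omega) ha.2 hd
          omega
      · ring
    · subst hak
      have h1 : u a ≤ a := (hu.mem (by omega)).2
      have h2 : a < z (a + 1) := (hz.mem (by omega)).1
      have hA : (u * z) a = u a := by rw [Equiv.Perm.mul_apply, hz a (by omega)]
      have hB : (u * z) (a + 1) = z (a + 1) := by rw [Equiv.Perm.mul_apply, hu _ (by omega)]
      rw [hA, hB, hz a (by omega), hu (a + 1) (by omega), if_neg (by omega),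
        if_neg (by omega), if_neg (by omega)]
      ring
    · have h1 : k < z a := (hz.mem (by omega)).1
      have h2 : k < z (a + 1) := (hz.mem (by omega)).1
      have hA : (u * z) a = z a := by rw [Equiv.Perm.mul_apply, hu _ (by omega)]
      have hB : (u * z) (a + 1) = z (a + 1) := by rw [Equiv.Perm.mul_apply, hu _ (by omega)]
      rw [hA, hB, hu a (by omega), hu (a + 1) (by omega),
        if_neg (show ¬ a + 1 < a by omega)]
      split_ifs with hd
      · rw [mul_assoc u, ih hu (hz.mul (Supp.sT hak ha.2))]
        · ring
        · have := len_mul_sT' (by omega) ha.2 hd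
          omega
      · ring

lemma len_supp {k n : ℕ} (hk : k ≤ n) {u : Equiv.Perm ℕ} (hu : Supp 0 k u) : len n u = len k u := by
  unfold len
  congr 1
  ext ⟨p, q⟩
  simp only [Finset.mem_filter, Finset.mem_product, Finset.mem_Icc]
  have key : ∀ p, (0 < p → p ≤ k → u p ≤ k) ∧ (k < p → u p = p) := fun p =>
    ⟨fun h h' => (hu.mem ⟨h, h'⟩).2, fun h => hu p (by omega)⟩
  have hp := key p
  have hq := key q
  omega

lemma Upsilon_supp {k n : ℕ} (hk : k ≤ n) (d : ℕ) : ∀ {u : Equiv.Perm ℕ}, Supp 0 k u →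
    len k u = d → Upsilon n u = Upsilon k u := by
  induction d with
  | zero =>
    intro u hu h
    rw [eq_one_of_len_eq_zero hu h, Upsilon_one, Upsilon_one]
  | succ d ih =>
    intro u hu h
    have hpos : ((d + 1 : ℕ) : ℚ) ≠ 0 := by positivity
    refine mul_left_cancel₀ hpos ?_
    have e1 := Upsilon_rec n u
    have e2 := Upsilon_rec k u
    rw [len_supp hk hu, h] at e1
    rw [h] at e2
    rw [e1, e2]
    rcases Nat.eq_zero_or_pos k with rfl | hk0
    · have : u = 1 := Equiv.ext fun p => hu p (by omega)
      rw [this, len_one] at h; omega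
    rw [← Finset.sum_Ico_consecutive _ hk0 hk, add_eq_left.2]
    · refine Finset.sum_congr rfl fun a ha => ?_
      have ha := Finset.mem_Ico.1 ha
      split_ifs with hd
      · rw [ih (hu.mul (Supp.sT (by omega) ha.2))]
        have := len_mul_sT' (by omega) ha.2 hd
        omega
      · rfl
    · refine Finset.sum_eq_zero fun a ha => if_neg ?_
      have ha := Finset.mem_Ico.1 ha
      rw [hu (a + 1) (by omega)]
      have : u a ≤ a := by
        by_cases h : a ≤ k
        · exact (hu.mem (by omega)).2.trans (by omega)
        · rw [hu a (by omega)]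
      omega

lemma layeredPerm_concat (l : List ℕ) (c : ℕ) :
    layeredPerm (l ++ [c]) = layeredPerm l * blockRev l.sum c := by
  rw [layeredPerm, List.length_append, List.length_singleton, List.range_succ, List.map_append,
    List.prod_append, layeredPerm]
  congr 1
  · congr 1
    refine List.map_congr_left fun j hj => ?_
    have hj := List.mem_range.1 hj
    rw [List.take_append_of_le_length hj.le, List.getD_append _ _ _ _ hj]
  · simp

lemma layeredPerm_supp (l : List ℕ) : Supp 0 l.sum (layeredPerm l) := by
  induction l using List.reverseRecOn with
  | nil => exact Supp.one _ _
  | append_singleton l c ih =>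
    rw [layeredPerm_concat, List.sum_append, List.sum_singleton]
    exact (ih.mono le_rfl (by omega)).mul ((blockRev_supp _ _).mono (by omega) le_rfl)

/-- The real value of the principal specialization at a layered permutation. -/
noncomputable def Ups (l : List ℕ) : ℝ := ((Upsilon l.sum (layeredPerm l) : ℚ) : ℝ)

/-- The contribution of a last layer of size `c` placed after a prefix of size `a`. -/
noncomputable def Qr (a c : ℕ) : ℝ :=
  ∏ l ∈ Finset.range c, ∏ l' ∈ Finset.range c,
    if l < l' then ((2 * a + l + l' + 1 : ℝ) / (l + l' + 1)) else 1

lemma Upsilon_blockRev_real (a c : ℕ) : ((Upsilon (a + c) (blockRev a c) : ℚ) : ℝ) = Qr a c := by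
  rw [add_comm a c, Upsilon_blockRev_eq, Qr, Rat.cast_prod, Finset.prod_range]
  refine Finset.prod_congr rfl fun l _ => ?_
  rw [Rat.cast_prod, Finset.prod_range, ← Finset.filter_lt_eq_Ioi, Finset.prod_filter]
  refine Finset.prod_congr rfl fun l' _ => ?_
  simp only [Fin.lt_def]
  split_ifs <;> push_cast <;> rfl

lemma Ups_nil : Ups [] = 1 := by
  have : layeredPerm [] = 1 := rfl
  rw [Ups, this, Upsilon_one, Rat.cast_one]

theorem Ups_concat (l : List ℕ) (c : ℕ) : Ups (l ++ [c]) = Ups l * Qr l.sum c := by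
  rw [Ups, layeredPerm_concat, List.sum_append, List.sum_singleton,
    Upsilon_mul (k := l.sum) (by omega) _ (layeredPerm_supp l) (blockRev_supp _ _) rfl,
    Upsilon_supp (k := l.sum) (by omega) _ (layeredPerm_supp l) rfl, Rat.cast_mul,
    Upsilon_blockRev_real, Ups]

end LimitShape

namespace LimitShape

/-- A second antiderivative of the logarithm. -/
noncomputable def phi (u : ℝ) : ℝ := u ^ 2 * Real.log u / 2 - 3 / 4 * u ^ 2

lemma phi_hasDerivAt {u : ℝ} (hu : 0 < u) : HasDerivAt phi (u * Real.log u - u) u := by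
  have h := ((((hasDerivAt_id u).pow 2).mul (Real.hasDerivAt_log hu.ne')).div_const 2).sub
    (((hasDerivAt_id u).pow 2).const_mul (3 / 4))
  refine h.congr_deriv ?_
  simp only [id, Pi.pow_apply]
  field_simp
  ring

lemma phi_continuous : Continuous phi := by
  have : phi = fun u => u * (u * Real.log u) / 2 - 3 / 4 * u ^ 2 := by
    funext u; rw [phi]; ring
  rw [this]
  have := Real.continuous_mul_log
  fun_prop

lemma xlogx_hasDerivAt {u : ℝ} (hu : 0 < u) :
    HasDerivAt (fun u => u * Real.log u - u) (Real.log u) u := by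
  have h := ((hasDerivAt_id u).mul (Real.hasDerivAt_log hu.ne')).sub (hasDerivAt_id u)
  refine h.congr_deriv ?_
  simp only [id]
  field_simp
  ring

lemma exists_log_eq_second_diff {u : ℝ} (hu : 1 ≤ u) : ∃ η, u - 1 < η ∧ η < u + 1 ∧
    phi (u + 1) - 2 * phi u + phi (u - 1) = Real.log η := by
  obtain ⟨ξ, ⟨h1, h2⟩, h3⟩ := exists_hasDerivAt_eq_slope (fun v => phi (v + 1) - phi v)
    (fun v => ((v + 1) * Real.log (v + 1) - (v + 1)) - (v * Real.log v - v))
    (show u - 1 < u by linarith)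
    ((phi_continuous.comp (continuous_id.add continuous_const)).sub phi_continuous).continuousOn
    (fun x hx => ((phi_hasDerivAt (by linarith [hx.1])).comp_add_const x 1).sub
      (phi_hasDerivAt (by linarith [hx.1])))
  obtain ⟨η, ⟨h4, h5⟩, h6⟩ := exists_hasDerivAt_eq_slope (fun v => v * Real.log v - v)
    Real.log (show ξ < ξ + 1 by linarith)
    ((Real.continuous_mul_log.sub continuous_id).continuousOn)
    (fun x hx => xlogx_hasDerivAt (by linarith [hx.1]))
  refine ⟨η, by linarith, by linarith, ?_⟩
  rw [h6, show ξ + 1 - ξ = 1 by ring, div_one, h3]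
  rw [show u - (u - 1) = 1 by ring, show u - 1 + 1 = u by ring]
  ring

lemma abs_second_diff_sub_log {u : ℕ} (hu : 1 ≤ u) :
    |phi (u + 1) - 2 * phi u + phi (u - 1) - Real.log u| ≤ 2 / u := by
  have hu' : (1 : ℝ) ≤ u := by exact_mod_cast hu
  rcases hu.eq_or_lt with rfl | h2
  · have h0 := Real.log_nonneg (show (1 : ℝ) ≤ 2 by norm_num)
    have h1 := Real.log_le_sub_one_of_pos (show (0 : ℝ) < 2 by norm_num)
    simp only [phi, Nat.cast_one]
    rw [abs_le]
    norm_num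
    constructor <;> linarith
  · have h2' : (2 : ℝ) ≤ u := by exact_mod_cast h2
    obtain ⟨η, h1, h3, h4⟩ := exists_log_eq_second_diff hu'
    rw [h4]
    have hη : 0 < η := by linarith
    have hupos : (0 : ℝ) < u := by linarith
    rw [← Real.log_div hη.ne' hupos.ne', abs_le]
    have hp : 0 < η / u := by positivity
    constructor
    · refine le_trans ?_ (Real.one_sub_inv_le_log_of_pos hp)
      rw [inv_div, neg_le_sub_iff_le_add, one_add_div hupos.ne', div_le_div_iff₀ hη hupos]
      nlinarith
    · refine (Real.log_le_sub_one_of_pos hp).trans ?_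
      rw [div_sub_one hupos.ne', div_le_div_iff_of_pos_right hupos]
      linarith

/-- The logarithm of the contribution of a last layer. -/
noncomputable def qr (a c : ℕ) : ℝ :=
  ∑ l ∈ Finset.range c, ∑ l' ∈ Finset.range c,
    if l < l' then Real.log ((2 * a + l + l' + 1 : ℝ) / (l + l' + 1)) else 0

lemma Qr_pos (a c : ℕ) : 0 < Qr a c :=
  Finset.prod_pos fun l _ => Finset.prod_pos fun l' _ => by
    split_ifs <;> positivity

lemma log_Qr (a c : ℕ) : Real.log (Qr a c) = qr a c := by
  have h : ∀ l l' : ℕ,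
      (if l < l' then ((2 * a + l + l' + 1 : ℝ) / (l + l' + 1)) else 1) ≠ 0 := fun l l' => by
    split_ifs <;> positivity
  rw [Qr, Real.log_prod fun l _ => Finset.prod_ne_zero_iff.2 fun l' _ => h l l', qr]
  refine Finset.sum_congr rfl fun l _ => ?_
  rw [Real.log_prod fun l' _ => h l l']
  refine Finset.sum_congr rfl fun l' _ => ?_
  split_ifs <;> simp

lemma double_sum_second_diff (K : ℕ → ℝ) (c : ℕ) :
    ∑ l ∈ Finset.range c, ∑ l' ∈ Finset.range c, (K (l + l' + 2) - 2 * K (l + l' + 1) + K (l + l'))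
      = K (2 * c) - 2 * K c + K 0 := by
  have h1 : ∀ l, ∑ l' ∈ Finset.range c, (K (l + l' + 2) - 2 * K (l + l' + 1) + K (l + l'))
      = (K (l + c + 1) - K (l + c)) - (K (l + 1) - K l) := fun l => by
    have := Finset.sum_range_sub (fun l' => K (l + l' + 1) - K (l + l')) c
    simp only [add_zero] at this
    rw [← this]
    refine Finset.sum_congr rfl fun l' _ => ?_
    ring_nf
  simp only [h1]
  rw [Finset.sum_sub_distrib, Finset.sum_range_sub K]
  have := Finset.sum_range_sub (fun l => K (l + c)) c
  simp only [Nat.add_right_comm _ 1 c] at this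
  rw [this]
  simp only [zero_add, ← two_mul]
  ring

lemma phi_f {a c : ℕ} (hc : 0 < c) : ((a + c : ℕ) : ℝ) ^ 2 * f ((a : ℝ) / (a + c : ℕ)) =
    ((phi (2 * a + (2 * c : ℕ)) - phi (2 * c : ℕ)) - 2 * (phi (2 * a + c) - phi c)
      + (phi (2 * a + (0 : ℕ)) - phi (0 : ℕ))) / 2 := by
  have hc' : (0 : ℝ) < c := by exact_mod_cast hc
  set n : ℝ := ((a + c : ℕ) : ℝ) with hn
  have hna : n = a + c := by rw [hn]; push_cast; ring
  have ha : (0 : ℝ) ≤ a := Nat.cast_nonneg a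
  have hnpos : 0 < n := by rw [hna]; linarith
  have e1 : (1 : ℝ) - a / n = c / n := by field_simp; linarith
  have e2 : (1 : ℝ) + a / n = (2 * a + c) / n := by field_simp; linarith
  have l1 : Real.log (c / n) = Real.log c - Real.log n := Real.log_div hc'.ne' hnpos.ne'
  have l2 : Real.log ((2 * a + c) / n) = Real.log (2 * a + c) - Real.log n :=
    Real.log_div (by positivity) hnpos.ne'
  have e3 : (2 : ℝ) * a + (2 * c : ℕ) = 2 * n := by rw [hna]; push_cast; ring
  have l3 : Real.log (2 * n) = Real.log 2 + Real.log n := Real.log_mul two_ne_zero hnpos.ne'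
  have l4 : Real.log (2 * c) = Real.log 2 + Real.log c := Real.log_mul two_ne_zero hc'.ne'
  have l5 : (a : ℝ) ^ 2 * Real.log (a / n) = a ^ 2 * (Real.log a - Real.log n) := by
    rcases ha.eq_or_lt with h | h
    · rw [← h]; simp
    · rw [Real.log_div h.ne' hnpos.ne']
  have l6 : (a : ℝ) ^ 2 * Real.log (2 * a) = a ^ 2 * (Real.log 2 + Real.log a) := by
    rcases ha.eq_or_lt with h | h
    · rw [← h]; simp
    · rw [Real.log_mul two_ne_zero h.ne']
  have hL : n ^ 2 * f (a / n) = a ^ 2 * Real.log (a / n) - 1 / 2 * c ^ 2 * Real.log (c / n)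
      - 1 / 2 * (2 * a + c) ^ 2 * Real.log ((2 * a + c) / n) + 2 * a * n * Real.log 2 := by
    rw [f, e1, e2]; field_simp
  rw [hL, e3]
  simp only [phi, Nat.cast_zero, add_zero, Nat.cast_mul, Nat.cast_ofNat]
  rw [l5, l1, l2, l3, l4]
  rw [hna] at *
  linear_combination (-1) * l6

/-- The contribution of a last layer agrees with the limit function up to a quasilinear error. -/
theorem qr_estimate {a c : ℕ} (hc : 0 < c) :
    |qr a c - ((a + c : ℕ) : ℝ) ^ 2 * f ((a : ℝ) / (a + c : ℕ))|
      ≤ 3 * c * (1 + Real.log (a + c : ℕ)) := by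
  set k : ℕ → ℝ := fun u => Real.log (2 * a + u) - Real.log u with hk
  set K : ℕ → ℝ := fun u => phi (2 * a + u) - phi u with hK
  have hc' : (1 : ℝ) ≤ c := by exact_mod_cast hc
  have hkl : ∀ l l' : ℕ, Real.log ((2 * a + l + l' + 1 : ℝ) / (l + l' + 1)) = k (l + l' + 1) :=
    fun l l' => by
      rw [Real.log_div (by positivity) (by positivity), hk]
      push_cast
      ring_nf
  have hq : qr a c = (∑ l ∈ Finset.range c, ∑ l' ∈ Finset.range c, k (l + l' + 1)
      - ∑ l ∈ Finset.range c, k (2 * l + 1)) / 2 := by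
    have hsym : ∑ l ∈ Finset.range c, ∑ l' ∈ Finset.range c, (if l' < l then k (l + l' + 1) else 0)
        = qr a c := by
      rw [Finset.sum_comm, qr]
      refine Finset.sum_congr rfl fun l _ => Finset.sum_congr rfl fun l' _ => ?_
      rw [hkl, add_comm l l']
    have hdiag : ∑ l ∈ Finset.range c, ∑ l' ∈ Finset.range c, (if l = l' then k (l + l' + 1) else 0)
        = ∑ l ∈ Finset.range c, k (2 * l + 1) := by
      refine Finset.sum_congr rfl fun l hl => ?_
      rw [Finset.sum_ite_eq, if_pos hl, two_mul]
    have hall : ∑ l ∈ Finset.range c, ∑ l' ∈ Finset.range c, k (l + l' + 1)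
        = qr a c + qr a c + ∑ l ∈ Finset.range c, k (2 * l + 1) := by
      nth_rewrite 2 [← hsym]
      rw [← hdiag, qr, ← Finset.sum_add_distrib, ← Finset.sum_add_distrib]
      refine Finset.sum_congr rfl fun l _ => ?_
      rw [← Finset.sum_add_distrib, ← Finset.sum_add_distrib]
      refine Finset.sum_congr rfl fun l' _ => ?_
      rw [hkl]
      rcases lt_trichotomy l l' with h | h | h
      · rw [if_pos h, if_neg (by omega), if_neg (by omega)]; ring
      · rw [if_neg (by omega), if_neg (by omega), if_pos h]; ring
      · rw [if_neg (by omega), if_pos h, if_neg (by omega)]; ring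
    rw [hall]; ring
  have hF : ((a + c : ℕ) : ℝ) ^ 2 * f ((a : ℝ) / (a + c : ℕ)) = (∑ l ∈ Finset.range c,
      ∑ l' ∈ Finset.range c, (K (l + l' + 2) - 2 * K (l + l' + 1) + K (l + l'))) / 2 := by
    rw [phi_f hc, double_sum_second_diff]
  have hterm : ∀ l l' : ℕ, |k (l + l' + 1) - (K (l + l' + 2) - 2 * K (l + l' + 1) + K (l + l'))|
      ≤ 4 * ((l' + 1 : ℕ) : ℝ)⁻¹ := fun l l' => by
    have h1 := abs_second_diff_sub_log (u := 2 * a + (l + l' + 1)) (by omega)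
    have h2 := abs_second_diff_sub_log (u := l + l' + 1) (by omega)
    have h3 : (2 : ℝ) / (2 * a + (l + l' + 1) : ℕ) ≤ 2 * ((l' + 1 : ℕ) : ℝ)⁻¹ := by
      rw [div_eq_mul_inv]
      exact mul_le_mul_of_nonneg_left (inv_anti₀ (by positivity)
        (by exact_mod_cast (by omega : l' + 1 ≤ 2 * a + (l + l' + 1)))) (by norm_num)
    have h4 : (2 : ℝ) / (l + l' + 1 : ℕ) ≤ 2 * ((l' + 1 : ℕ) : ℝ)⁻¹ := by
      rw [div_eq_mul_inv]
      exact mul_le_mul_of_nonneg_left (inv_anti₀ (by positivity)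
        (by exact_mod_cast (by omega : l' + 1 ≤ l + l' + 1))) (by norm_num)
    have e : k (l + l' + 1) - (K (l + l' + 2) - 2 * K (l + l' + 1) + K (l + l')) =
        -(phi ((2 * a + (l + l' + 1) : ℕ) + 1) - 2 * phi (2 * a + (l + l' + 1) : ℕ)
          + phi ((2 * a + (l + l' + 1) : ℕ) - 1) - Real.log (2 * a + (l + l' + 1) : ℕ))
        + (phi ((l + l' + 1 : ℕ) + 1) - 2 * phi (l + l' + 1 : ℕ)
          + phi ((l + l' + 1 : ℕ) - 1) - Real.log (l + l' + 1 : ℕ)) := by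
      simp only [hk, hK]
      push_cast
      ring_nf
    rw [e]
    refine (abs_add_le _ _).trans ?_
    rw [abs_neg]
    linarith
  have hharm : ∑ l' ∈ Finset.range c, ((l' + 1 : ℕ) : ℝ)⁻¹ ≤ 1 + Real.log c := by
    have := harmonic_le_one_add_log c
    rw [harmonic] at this
    push_cast at this ⊢
    exact this
  have hlogc : Real.log c ≤ Real.log (a + c : ℕ) :=
    Real.log_le_log (by linarith) (by push_cast; linarith [Nat.cast_nonneg (α := ℝ) a])
  have hd1 : |∑ l ∈ Finset.range c, ∑ l' ∈ Finset.range c, k (l + l' + 1) - ∑ l ∈ Finset.range c,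
      ∑ l' ∈ Finset.range c, (K (l + l' + 2) - 2 * K (l + l' + 1) + K (l + l'))|
      ≤ c * (4 * (1 + Real.log (a + c : ℕ))) := by
    rw [← Finset.sum_sub_distrib]
    refine (Finset.abs_sum_le_sum_abs _ _).trans ?_
    rw [← nsmul_eq_mul]
    conv_rhs => rw [← Finset.card_range c]
    refine Finset.sum_le_card_nsmul _ _ _ fun l _ => ?_
    rw [← Finset.sum_sub_distrib]
    refine (Finset.abs_sum_le_sum_abs _ _).trans ?_
    refine (Finset.sum_le_sum fun l' _ => hterm l l').trans ?_
    rw [← Finset.mul_sum]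
    simp only [Finset.card_range]
    linarith
  have hd2 : |∑ l ∈ Finset.range c, k (2 * l + 1)| ≤ c * (2 * (1 + Real.log (a + c : ℕ))) := by
    refine (Finset.abs_sum_le_sum_abs _ _).trans ?_
    rw [← nsmul_eq_mul]
    conv_rhs => rw [← Finset.card_range c]
    refine Finset.sum_le_card_nsmul _ _ _ fun l _ => ?_
    simp only [Finset.card_range]
    have hl : (1 : ℝ) ≤ (2 * l + 1 : ℕ) := by exact_mod_cast (by omega)
    have ha : (0 : ℝ) ≤ a := Nat.cast_nonneg a
    have hn1 : (1 : ℝ) ≤ (a + c : ℕ) := by exact_mod_cast (by omega)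
    have h0 : 0 ≤ k (2 * l + 1) := by
      simp only [hk, sub_nonneg]
      exact Real.log_le_log (by linarith) (by linarith)
    rw [abs_of_nonneg h0]
    have h1 : k (2 * l + 1) ≤ Real.log (2 * (a + c : ℕ)) := by
      simp only [hk]
      rw [← Real.log_div (by positivity) (by positivity)]
      refine Real.log_le_log (by positivity) ?_
      rw [div_le_iff₀ (by linarith)]
      push_cast at *
      nlinarith
    rw [Real.log_mul two_ne_zero (by linarith)] at h1
    have h2 := Real.log_le_sub_one_of_pos (show (0 : ℝ) < 2 by norm_num)
    have h3 := Real.log_nonneg hn1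
    linarith
  rw [hq, hF]
  rw [abs_le] at *
  constructor <;> linarith [hd1.1, hd1.2, hd2.1, hd2.2]

end LimitShape

namespace LimitShape

open Set Filter Topology

/-- The growth constant obtained when all layers shrink by the ratio `x`. -/
noncomputable def rate (x : ℝ) : ℝ := f x / (1 - x ^ 2)

lemma f_zero : f 0 = 0 := by simp [f]

lemma f_differentiableAt {x : ℝ} (hx : x ∈ Ioo (0 : ℝ) 1) : DifferentiableAt ℝ f x := by
  have h1 : x ≠ 0 := hx.1.ne'
  have h2 : 1 - x ≠ 0 := by linarith [hx.2]
  have h3 : 1 + x ≠ 0 := by linarith [hx.1]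
  unfold f
  fun_prop (disch := assumption)

/-- The part of `f` which is smooth at `1`. -/
noncomputable def smoothPart (x : ℝ) : ℝ :=
  x ^ 2 * Real.log x - (1 / 2) * (1 + x) ^ 2 * Real.log (1 + x) + 2 * x * Real.log 2

lemma f_eq_smoothPart (x : ℝ) :
    f x = smoothPart x - 1 / 2 * (1 - x) * ((1 - x) * Real.log (1 - x)) := by
  rw [f, smoothPart]; ring

lemma smoothPart_one : smoothPart 1 = 0 := by
  rw [smoothPart]; norm_num

lemma smoothPart_hasDerivAt : HasDerivAt smoothPart 0 1 := by
  have h := ((((hasDerivAt_id (1 : ℝ)).pow 2).mul (Real.hasDerivAt_log one_ne_zero)).sub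
    (((((hasDerivAt_id (1 : ℝ)).const_add 1).pow 2).const_mul (1 / 2)).mul
      (((hasDerivAt_id (1 : ℝ)).const_add 1).log (by norm_num)))).add
    (((hasDerivAt_id (1 : ℝ)).const_mul 2).mul_const (Real.log 2))
  refine h.congr_deriv ?_
  simp only [id, Pi.pow_apply]
  norm_num

lemma f_continuous : Continuous f := by
  have : f = fun x => x * (x * Real.log x) - 1 / 2 * (1 - x) * ((1 - x) * Real.log (1 - x))
      - 1 / 2 * (1 + x) * ((1 + x) * Real.log (1 + x)) + 2 * x * Real.log 2 := by
    funext x; rw [f]; ring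
  rw [this]
  have h := Real.continuous_mul_log
  have h1 : Continuous fun x : ℝ => (1 - x) * Real.log (1 - x) := h.comp (by fun_prop)
  have h2 : Continuous fun x : ℝ => (1 + x) * Real.log (1 + x) := h.comp (by fun_prop)
  fun_prop

lemma rate_continuousOn : ContinuousOn rate (Icc 0 1) := by
  intro x hx
  apply ContinuousAt.continuousWithinAt
  rcases hx.2.eq_or_lt with rfl | h
  · have he : ∀ᶠ y in 𝓝 (1 : ℝ), rate y = -dslope smoothPart 1 y / (1 + y)
        - 1 / 2 * ((1 - y) * Real.log (1 - y)) / (1 + y) := by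
      filter_upwards [lt_mem_nhds (show (0 : ℝ) < 1 by norm_num)] with y hy
      rcases eq_or_ne y 1 with rfl | hne
      · simp [rate, dslope_same, smoothPart_hasDerivAt.deriv]
      · have h1 : 1 - y ≠ 0 := sub_ne_zero.2 hne.symm
        have h1' : y - 1 ≠ 0 := sub_ne_zero.2 hne
        have h2 : 1 + y ≠ 0 := by linarith
        have h3 : 1 - y ^ 2 = (1 - y) * (1 + y) := by ring
        rw [rate, dslope_of_ne _ hne, slope_def_field, smoothPart_one, f_eq_smoothPart, h3]
        field_simp
        ring
    refine ContinuousAt.congr ?_ (he.mono fun y hy => hy.symm)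
    have h1 : ContinuousAt (dslope smoothPart 1) 1 :=
      continuousAt_dslope_same.2 smoothPart_hasDerivAt.differentiableAt
    have h2 : ContinuousAt (fun x : ℝ => (1 - x) * Real.log (1 - x)) 1 :=
      (Real.continuous_mul_log.comp (by fun_prop : Continuous fun x : ℝ => 1 - x)).continuousAt
    have h3 : (1 : ℝ) + 1 ≠ 0 := by norm_num
    have h4 : ContinuousAt (fun y : ℝ => 1 + y) 1 := by fun_prop
    exact (h1.neg.div h4 h3).sub ((continuousAt_const.mul h2).div h4 h3)
  · refine f_continuous.continuousAt.div (by fun_prop) ?_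
    have := hx.1
    nlinarith

lemma rate_zero : rate 0 = 0 := by simp [rate, f_zero]

lemma rate_one : rate 1 = 0 := by simp [rate]

lemma rate_half_pos : 0 < rate (1 / 2) := by
  have h : 9 * Real.log 3 < 16 * Real.log 2 := by
    have := Real.log_lt_log (by norm_num) (show (3 : ℝ) ^ 9 < 2 ^ 16 by norm_num)
    rw [Real.log_pow, Real.log_pow] at this
    exact_mod_cast this
  have h1 : Real.log (1 / 2) = -Real.log 2 := by rw [one_div, Real.log_inv]
  have h2 : Real.log (1 + 1 / 2) = Real.log 3 - Real.log 2 := by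
    rw [← Real.log_div (by norm_num) (by norm_num)]; norm_num
  refine div_pos ?_ (by norm_num)
  rw [f, h2, show (1 : ℝ) - 1 / 2 = 1 / 2 by norm_num, h1]
  linarith

/-- The critical ratio is the unique maximizer of the growth rate. -/
lemma rate_lt_of_ne {α : ℝ}
    (huniq : ∀ β ∈ Ioo (0 : ℝ) 1, 2 * β * f β + (1 - β ^ 2) * deriv f β = 0 → β = α) :
    ∀ x ∈ Icc (0 : ℝ) 1, x ≠ α → rate x < rate α := by
  have key : ∀ x ∈ Icc (0 : ℝ) 1, IsMaxOn rate (Icc 0 1) x → x = α := fun x hx hm => by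
    have hpos : 0 < rate x := rate_half_pos.trans_le (hm (by norm_num))
    have hx' : x ∈ Ioo (0 : ℝ) 1 := by
      refine ⟨lt_of_le_of_ne hx.1 ?_, lt_of_le_of_ne hx.2 ?_⟩
      · rintro rfl; exact hpos.ne' rate_zero
      · rintro rfl; exact hpos.ne' rate_one
    have hne : 1 - x ^ 2 ≠ 0 := by nlinarith [hx'.1, hx'.2]
    have hd := (f_differentiableAt hx').hasDerivAt.div (((hasDerivAt_id x).pow 2).const_sub 1) hne
    have h0 := (hm.isLocalMax (Icc_mem_nhds hx'.1 hx'.2)).hasDerivAt_eq_zero hd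
    refine huniq x hx' ?_
    simp only [id, Pi.pow_apply] at h0
    rw [div_eq_zero_iff, or_iff_left (pow_ne_zero 2 hne)] at h0
    norm_num at h0
    linarith
  obtain ⟨x0, hx0, hm⟩ := isCompact_Icc.exists_isMaxOn (nonempty_Icc.2 zero_le_one)
    rate_continuousOn
  obtain rfl := key x0 hx0 hm
  intro x hx hne
  refine lt_of_le_of_ne (hm hx) fun h => hne (key x hx fun y hy => ?_)
  rw [mem_ofPred_eq, h]
  exact hm hy

lemma rate_le {α : ℝ} (hlt : ∀ x ∈ Icc (0 : ℝ) 1, x ≠ α → rate x < rate α) :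
    ∀ x ∈ Icc (0 : ℝ) 1, rate x ≤ rate α := fun x hx => by
  rcases eq_or_ne x α with rfl | h
  · exact le_rfl
  · exact (hlt x hx h).le

lemma rate_stable {α : ℝ}
    (hlt : ∀ x ∈ Icc (0 : ℝ) 1, x ≠ α → rate x < rate α) {η : ℝ} (hη : 0 < η) :
    ∃ ε > 0, ∀ x ∈ Icc (0 : ℝ) 1, η ≤ |x - α| → rate x + ε ≤ rate α := by
  have hK : IsCompact (Icc (0 : ℝ) 1 ∩ {x | η ≤ |x - α|}) :=
    isCompact_Icc.inter_right (isClosed_le (by fun_prop) (by fun_prop))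
  rcases (Icc (0 : ℝ) 1 ∩ {x | η ≤ |x - α|}).eq_empty_or_nonempty with h | h
  · exact ⟨1, one_pos, fun x hx hx' => (h.subset ⟨hx, hx'⟩).elim⟩
  · obtain ⟨y, hy, hm⟩ := hK.exists_isMaxOn h (rate_continuousOn.mono inter_subset_left)
    refine ⟨rate α - rate y, sub_pos.2 (hlt y hy.1 ?_), fun x hx hx' => ?_⟩
    · rintro rfl
      have := hy.2
      simp at this
      linarith
    · have : rate x ≤ rate y := hm ⟨hx, hx'⟩
      linarith

end LimitShape

namespace LimitShape

open Set Filter Topology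

lemma Ups_pos (l : List ℕ) : 0 < Ups l := by
  induction l using List.reverseRecOn with
  | nil => rw [Ups_nil]; exact one_pos
  | append_singleton l c ih => rw [Ups_concat]; exact mul_pos ih (Qr_pos _ _)

lemma log_Ups_concat (l : List ℕ) (c : ℕ) :
    Real.log (Ups (l ++ [c])) = Real.log (Ups l) + qr l.sum c := by
  rw [Ups_concat, Real.log_mul (Ups_pos l).ne' (Qr_pos _ _).ne', log_Qr]

/-- A composition is optimal if it has positive parts and maximizes `Ups` among all
compositions of the same number. -/
def Opt (l : List ℕ) : Prop :=
  (∀ c ∈ l, 0 < c) ∧ ∀ l' : List ℕ, (∀ c ∈ l', 0 < c) → l'.sum = l.sum → Ups l' ≤ Ups l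

lemma forall_mem_concat {l : List ℕ} {c : ℕ} :
    (∀ x ∈ l ++ [c], 0 < x) ↔ (∀ x ∈ l, 0 < x) ∧ 0 < c := by
  simp only [List.mem_append, List.mem_singleton]
  exact ⟨fun h => ⟨fun x hx => h x (Or.inl hx), h c (Or.inr rfl)⟩,
    fun h x hx => hx.elim (h.1 x) fun e => e ▸ h.2⟩

lemma Opt.init {l : List ℕ} {c : ℕ} (h : Opt (l ++ [c])) : Opt l := by
  have hp := forall_mem_concat.1 h.1
  refine ⟨hp.1, fun l' hl' hs => ?_⟩
  have := h.2 (l' ++ [c]) (forall_mem_concat.2 ⟨hl', hp.2⟩) (by simp [hs])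
  rw [Ups_concat, Ups_concat, hs] at this
  exact le_of_mul_le_mul_right this (Qr_pos _ _)

/-- The amount by which the logarithm of `Ups` falls short of a simple upper bound. -/
noncomputable def deficit (H : ℝ) (l : List ℕ) : ℝ :=
  H * (l.sum : ℝ) ^ 2 + 3 * l.sum * (1 + Real.log l.sum) - Real.log (Ups l)

lemma sq_mul_f {a c : ℕ} (hc : 0 < c) : ((a + c : ℕ) : ℝ) ^ 2 * f ((a : ℝ) / (a + c : ℕ)) =
    (((a + c : ℕ) : ℝ) ^ 2 - (a : ℝ) ^ 2) * rate ((a : ℝ) / (a + c : ℕ)) := by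
  have hc' : (0 : ℝ) < c := by exact_mod_cast hc
  have ha : (0 : ℝ) ≤ a := Nat.cast_nonneg a
  have hn : (0 : ℝ) < (a + c : ℕ) := by push_cast; linarith
  have h : (((a + c : ℕ) : ℝ) ^ 2 - (a : ℝ) ^ 2) ≠ 0 := by push_cast; nlinarith
  have e : 1 - ((a : ℝ) / (a + c : ℕ)) ^ 2 =
      (((a + c : ℕ) : ℝ) ^ 2 - (a : ℝ) ^ 2) / ((a + c : ℕ) : ℝ) ^ 2 := by
    rw [div_pow, one_sub_div (pow_ne_zero 2 hn.ne')]
  rw [rate, e]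
  field_simp

lemma mul_log_mono {a n : ℕ} (h : a ≤ n) :
    3 * (a : ℝ) * (1 + Real.log a) ≤ 3 * a * (1 + Real.log n) := by
  rcases a.eq_zero_or_pos with rfl | ha
  · simp
  · have : Real.log a ≤ Real.log n :=
      Real.log_le_log (by exact_mod_cast ha) (by exact_mod_cast h)
    gcongr

lemma deficit_concat (H : ℝ) (l : List ℕ) {c : ℕ} (hc : 0 < c) :
    deficit H l + (((l.sum + c : ℕ) : ℝ) ^ 2 - (l.sum : ℝ) ^ 2) *
      (H - rate ((l.sum : ℝ) / (l.sum + c : ℕ))) ≤ deficit H (l ++ [c]) := by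
  have h1 := (abs_le.1 (qr_estimate (a := l.sum) hc)).2
  have h2 := mul_log_mono (Nat.le_add_right l.sum c)
  rw [sq_mul_f hc] at h1
  rw [deficit, deficit, log_Ups_concat, List.sum_append, List.sum_singleton]
  have h3 : 3 * ((l.sum + c : ℕ) : ℝ) * (1 + Real.log (l.sum + c : ℕ)) =
      3 * l.sum * (1 + Real.log (l.sum + c : ℕ)) + 3 * c * (1 + Real.log (l.sum + c : ℕ)) := by
    push_cast; ring
  linarith

lemma deficit_concat_le (H : ℝ) (l : List ℕ) {c : ℕ} (hc : 0 < c) :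
    deficit H (l ++ [c]) ≤ deficit H l + (((l.sum + c : ℕ) : ℝ) ^ 2 - (l.sum : ℝ) ^ 2) *
      (H - rate ((l.sum : ℝ) / (l.sum + c : ℕ)))
      + 6 * (l.sum + c : ℕ) * (1 + Real.log (l.sum + c : ℕ)) := by
  have h1 := (abs_le.1 (qr_estimate (a := l.sum) hc)).1
  rw [sq_mul_f hc] at h1
  rw [deficit, deficit, log_Ups_concat, List.sum_append, List.sum_singleton]
  have h0 : 0 ≤ 3 * (l.sum : ℝ) * (1 + Real.log l.sum) := by
    have := Real.log_natCast_nonneg l.sum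
    positivity
  have h2 := mul_nonneg (Nat.cast_nonneg (α := ℝ) l.sum)
    (add_nonneg zero_le_one (Real.log_natCast_nonneg (l.sum + c)))
  have h3 : 3 * ((l.sum + c : ℕ) : ℝ) * (1 + Real.log (l.sum + c : ℕ)) =
      3 * (l.sum * (1 + Real.log (l.sum + c : ℕ))) + 3 * c * (1 + Real.log (l.sum + c : ℕ)) := by
    push_cast; ring
  linarith

lemma ratio_mem (a c : ℕ) : (a : ℝ) / (a + c : ℕ) ∈ Icc (0 : ℝ) 1 :=
  ⟨by positivity, div_le_one_of_le₀ (by exact_mod_cast Nat.le_add_right a c) (by positivity)⟩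

lemma sq_sub_sq_nonneg (a c : ℕ) : 0 ≤ ((a + c : ℕ) : ℝ) ^ 2 - (a : ℝ) ^ 2 := by
  have : (a : ℝ) ≤ (a + c : ℕ) := by exact_mod_cast Nat.le_add_right a c
  have := pow_le_pow_left₀ (Nat.cast_nonneg a) this 2
  linarith

lemma deficit_le_concat {H : ℝ} (hH : ∀ x ∈ Icc (0 : ℝ) 1, rate x ≤ H) (l : List ℕ) {c : ℕ}
    (hc : 0 < c) : deficit H l ≤ deficit H (l ++ [c]) := by
  have h := deficit_concat H l hc
  have := mul_nonneg (sq_sub_sq_nonneg l.sum c) (sub_nonneg.2 (hH _ (ratio_mem l.sum c)))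
  linarith

lemma deficit_nonneg {H : ℝ} (hH : ∀ x ∈ Icc (0 : ℝ) 1, rate x ≤ H) (l : List ℕ)
    (hl : ∀ c ∈ l, 0 < c) : 0 ≤ deficit H l := by
  induction l using List.reverseRecOn with
  | nil => simp [deficit, Ups_nil]
  | append_singleton l c ih =>
    have hp := forall_mem_concat.1 hl
    exact (ih hp.1).trans (deficit_le_concat hH l hp.2)

lemma exists_deficit_le {α : ℝ} (hα : α ∈ Ioo (0 : ℝ) 1) {ε : ℝ} (hε : 0 < ε) :
    ∃ C : ℝ, ∀ n : ℕ, ∃ l : List ℕ, (∀ c ∈ l, 0 < c) ∧ l.sum = n ∧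
      deficit (rate α) l ≤ ε * (n : ℝ) ^ 2 + C := by
  have hα2 : 0 < 1 - α ^ 2 := by nlinarith [hα.1, hα.2]
  have hlim : Tendsto (fun n : ℕ => rate ((⌊α * n⌋₊ : ℝ) / n)) atTop (𝓝 (rate α)) :=
    (rate_continuousOn.continuousAt (Icc_mem_nhds hα.1 hα.2)).tendsto.comp
      ((tendsto_nat_floor_mul_div_atTop hα.1.le).comp tendsto_natCast_atTop_atTop)
  have hlog : Tendsto (fun n : ℕ => (1 + Real.log n) / n) atTop (𝓝 0) := by
    have h1 : Tendsto (fun x : ℝ => Real.log x / x) atTop (𝓝 0) :=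
      Real.isLittleO_log_id_atTop.tendsto_div_nhds_zero
    have h2 := tendsto_inv_atTop_zero.add h1
    rw [add_zero] at h2
    refine (h2.comp tendsto_natCast_atTop_atTop).congr fun n => ?_
    simp only [Function.comp]
    ring
  have hev : ∀ᶠ n : ℕ in atTop, rate α - ε / 2 < rate ((⌊α * n⌋₊ : ℝ) / n) ∧
      (1 + Real.log n) / n < ε / 12 * (1 - α ^ 2) ∧ 1 ≤ n :=
    (hlim.eventually (lt_mem_nhds (by linarith))).and
      ((hlog.eventually (gt_mem_nhds (by positivity))).and (eventually_ge_atTop 1))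
  obtain ⟨N, hN⟩ := eventually_atTop.1 hev
  obtain ⟨C, hC⟩ := ((Set.finite_lt_nat N).image
    fun n => deficit (rate α) (List.replicate n 1)).bddAbove
  refine ⟨max C 0, fun n => ?_⟩
  induction n using Nat.strong_induction_on with
  | _ n ih =>
  rcases lt_or_ge n N with hn | hn
  · refine ⟨List.replicate n 1, fun c hc => ?_, by simp, ?_⟩
    · rw [List.eq_of_mem_replicate hc]; exact one_pos
    · have h1 : deficit (rate α) (List.replicate n 1) ≤ C := hC ⟨n, hn, rfl⟩
      have h2 := le_max_left C 0
      have : 0 ≤ ε * (n : ℝ) ^ 2 := by positivity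
      linarith
  · obtain ⟨h1, h2, h3⟩ := hN n hn
    have hn0 : (0 : ℝ) < n := by exact_mod_cast h3
    have hfl : (⌊α * n⌋₊ : ℝ) ≤ α * n := Nat.floor_le (mul_nonneg hα.1.le hn0.le)
    set a := ⌊α * n⌋₊ with ha
    have han : a < n := by
      have : (a : ℝ) < n := hfl.trans_lt (by nlinarith [hα.2])
      exact_mod_cast this
    obtain ⟨l, hl1, hl2, hl3⟩ := ih a han
    have hc : 0 < n - a := by omega
    have hs : a + (n - a) = n := by omega
    refine ⟨l ++ [n - a], forall_mem_concat.2 ⟨hl1, hc⟩, by simp [hl2, hs], ?_⟩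
    refine (deficit_concat_le _ _ hc).trans ?_
    rw [hl2, hs]
    have ha2 : (a : ℝ) ^ 2 ≤ α ^ 2 * (n : ℝ) ^ 2 := by
      rw [← mul_pow]; exact pow_le_pow_left₀ (Nat.cast_nonneg a) hfl 2
    rw [div_lt_iff₀ hn0] at h2
    have h4 : 0 ≤ (n : ℝ) ^ 2 - (a : ℝ) ^ 2 := by nlinarith [sq_nonneg (n : ℝ)]
    have h5 := mul_le_mul_of_nonneg_left (show rate α - rate (a / n) ≤ ε / 2 by linarith) h4
    have h6 : 6 * (n : ℝ) * (1 + Real.log n) ≤ ε / 2 * ((1 - α ^ 2) * (n : ℝ) ^ 2) := by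
      have := mul_le_mul_of_nonneg_left h2.le (show (0 : ℝ) ≤ 6 * n by positivity)
      linarith
    have h7 : ε / 2 * ((1 - α ^ 2) * (n : ℝ) ^ 2) ≤ ε / 2 * ((n : ℝ) ^ 2 - (a : ℝ) ^ 2) :=
      mul_le_mul_of_nonneg_left (by linarith) (by positivity)
    linarith

lemma Opt.deficit_le {α : ℝ} (hα : α ∈ Ioo (0 : ℝ) 1) {ε : ℝ} (hε : 0 < ε) :
    ∃ N : ℕ, ∀ l : List ℕ, Opt l → N ≤ l.sum →
      deficit (rate α) l ≤ ε * (l.sum : ℝ) ^ 2 := by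
  obtain ⟨C, hC⟩ := exists_deficit_le hα (half_pos hε)
  have hev : ∀ᶠ n : ℕ in atTop, C ≤ ε / 2 * (n : ℝ) ^ 2 :=
    (((tendsto_pow_atTop two_ne_zero).comp tendsto_natCast_atTop_atTop).const_mul_atTop
      (half_pos hε)).eventually_ge_atTop C
  obtain ⟨N, hN⟩ := eventually_atTop.1 hev
  refine ⟨N, fun l hl hn => ?_⟩
  obtain ⟨l', h1, h2, h3⟩ := hC l.sum
  have h4 := Real.log_le_log (Ups_pos l') (hl.2 l' h1 h2)
  have h5 := hN _ hn
  rw [deficit, h2] at h3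
  rw [deficit]
  linarith

end LimitShape

namespace LimitShape

open Set Filter Topology

lemma qr_succ (a c : ℕ) : qr a (c + 1) = qr a c +
    ∑ l ∈ Finset.range c, Real.log ((2 * a + l + c + 1 : ℝ) / (l + c + 1)) := by
  have h : ∑ l' ∈ Finset.range (c + 1), (if c < l' then
      Real.log ((2 * a + c + l' + 1 : ℝ) / (c + l' + 1)) else 0) = 0 :=
    Finset.sum_eq_zero fun l' hl' => if_neg (by have := Finset.mem_range.1 hl'; omega)
  rw [qr, Finset.sum_range_succ, h, add_zero, qr, ← Finset.sum_add_distrib]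
  refine Finset.sum_congr rfl fun l hl => ?_
  rw [Finset.sum_range_succ, if_pos (Finset.mem_range.1 hl)]

lemma qr_merge (a d c : ℕ) : qr a (d + c) - qr a d - qr (a + d) c =
    ∑ k ∈ Finset.range c, (∑ l ∈ Finset.range d,
        Real.log ((2 * a + l + d + k + 1 : ℝ) / (l + d + k + 1))
      - ∑ j ∈ Finset.range k, Real.log ((2 * d + j + k + 1 : ℝ) / (j + k + 1))) := by
  induction c with
  | zero => simp [qr]
  | succ c ih =>
    rw [Finset.sum_range_succ, ← ih, ← add_assoc, qr_succ, qr_succ, Finset.sum_range_add]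
    have h1 : ∑ l ∈ Finset.range d, Real.log ((2 * a + l + (d + c : ℕ) + 1 : ℝ)
        / (l + (d + c : ℕ) + 1)) = ∑ l ∈ Finset.range d,
        Real.log ((2 * a + l + d + c + 1 : ℝ) / (l + d + c + 1)) := by
      refine Finset.sum_congr rfl fun l _ => ?_
      push_cast
      ring_nf
    have h2 : ∑ j ∈ Finset.range c, Real.log ((2 * a + (d + j : ℕ) + (d + c : ℕ) + 1 : ℝ)
        / ((d + j : ℕ) + (d + c : ℕ) + 1)) = ∑ j ∈ Finset.range c,
          Real.log ((2 * (a + d : ℕ) + j + c + 1 : ℝ) / (j + c + 1))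
        - ∑ j ∈ Finset.range c, Real.log ((2 * d + j + c + 1 : ℝ) / (j + c + 1)) := by
      rw [← Finset.sum_sub_distrib]
      refine Finset.sum_congr rfl fun j _ => ?_
      rw [← Real.log_div (by positivity) (by positivity), div_div_div_cancel_right₀ (by positivity)]
      push_cast
      ring_nf
    rw [h1, h2]
    ring

lemma two_lt_log_nine : 2 < Real.log 9 := by
  rw [Real.lt_log_iff_exp_lt (by norm_num), show (2 : ℝ) = 1 + 1 by norm_num, Real.exp_add]
  have := Real.exp_one_lt_d9
  have := Real.exp_pos 1
  nlinarith

lemma merge_first_ge {a d k : ℕ} {t : ℝ} (ht : 0 < t) (h : t * (2 * d + k) ≤ 2 * a) :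
    d * Real.log (1 + t) ≤ ∑ l ∈ Finset.range d,
      Real.log ((2 * a + l + d + k + 1 : ℝ) / (l + d + k + 1)) := by
  rw [← nsmul_eq_mul]
  conv_lhs => rw [← Finset.card_range d]
  refine Finset.card_nsmul_le_sum _ _ _ fun l hl => ?_
  have hl' : (l : ℝ) + 1 ≤ d := by exact_mod_cast Finset.mem_range.1 hl
  refine Real.log_le_log (by positivity) ?_
  rw [le_div_iff₀ (by positivity)]
  nlinarith

lemma merge_second_le (d : ℕ) {k : ℕ} (hk : 0 < k) :
    ∑ j ∈ Finset.range k, Real.log ((2 * d + j + k + 1 : ℝ) / (j + k + 1))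
      ≤ k * Real.log (1 + 2 * d / k) := by
  have hk' : (0 : ℝ) < k := by exact_mod_cast hk
  rw [← nsmul_eq_mul]
  conv_rhs => rw [← Finset.card_range k]
  refine Finset.sum_le_card_nsmul _ _ _ fun j _ => ?_
  have hj : (0 : ℝ) ≤ j := Nat.cast_nonneg j
  have hd : (0 : ℝ) ≤ d := Nat.cast_nonneg d
  rw [Finset.card_range]
  refine Real.log_le_log (by positivity) ?_
  rw [div_le_iff₀ (by positivity), one_add_div hk'.ne', div_mul_eq_mul_div, le_div_iff₀ hk']
  nlinarith [mul_nonneg hd hj]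

/-- A very short last layer is better merged into the layer before it. -/
lemma exists_merge {δ : ℝ} (hδ : 0 < δ) : ∃ δ' > (0 : ℝ), ∀ a d c : ℕ, 0 < d → 0 < c →
    δ * (a + d + c) ≤ a → c ≤ δ' * (a + d + c) → qr a d + qr (a + d) c < qr a (d + c) := by
  have hlam : 0 < Real.log (1 + δ) := Real.log_pos (by linarith)
  have hlim : Tendsto (fun y : ℝ => Real.log (1 + y) / y) atTop (𝓝 0) := by
    have h1 : Tendsto (fun x : ℝ => Real.log x / x) atTop (𝓝 0) :=
      Real.isLittleO_log_id_atTop.tendsto_div_nhds_zero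
    have h2 := (h1.comp (tendsto_atTop_add_const_left _ 1 tendsto_id)).mul
      (tendsto_inv_atTop_zero.const_add (1 : ℝ))
    rw [zero_mul] at h2
    refine h2.congr' ?_
    filter_upwards [eventually_gt_atTop 0] with y hy
    simp only [Function.comp, id]
    field_simp
    ring
  obtain ⟨B, hB⟩ := eventually_atTop.1 ((hlim.eventually (gt_mem_nhds
    (show (0 : ℝ) < Real.log (1 + δ) / 4 by positivity))).and (eventually_gt_atTop 0))
  have hB0 : 0 < B := (hB B le_rfl).2
  refine ⟨δ / (4 * (B + 1)), by positivity, fun a d c hd hc h1 h2 => ?_⟩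
  have hd' : (0 : ℝ) < d := by exact_mod_cast hd
  have hn : (0 : ℝ) < a + d + c := by positivity
  have ha : (0 : ℝ) < a := lt_of_lt_of_le (by positivity) h1
  rw [← sub_pos, ← sub_sub, qr_merge]
  refine Finset.sum_pos (fun k hk => ?_) ⟨0, Finset.mem_range.2 hc⟩
  rw [sub_pos]
  have hkc : (k : ℝ) ≤ c := by exact_mod_cast (Finset.mem_range.1 hk).le
  have hk0 : (0 : ℝ) ≤ k := Nat.cast_nonneg k
  have hmain := merge_first_ge (a := a) (d := d) (k := k) hδ (by nlinarith)
  have hdl : 0 < d * Real.log (1 + δ) := by positivity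
  rcases k.eq_zero_or_pos with rfl | hkpos
  · simp only [Finset.range_zero, Finset.sum_empty]
    exact hdl.trans_le hmain
  · have hk' : (0 : ℝ) < k := by exact_mod_cast hkpos
    have hsec := merge_second_le d hkpos
    rcases le_or_gt (B * k) (2 * d) with h | h
    · refine hsec.trans_lt (lt_of_lt_of_le ?_ hmain)
      have h3 := hB (2 * d / k) ((le_div_iff₀ hk').2 h)
      have h4 := (div_lt_iff₀ h3.2).1 h3.1
      have h5 := mul_lt_mul_of_pos_left h4 hk'
      have h6 : (k : ℝ) * (Real.log (1 + δ) / 4 * (2 * d / k)) = d * Real.log (1 + δ) / 2 := by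
        field_simp; ring
      linarith
    · have h8 : 8 * (2 * (d : ℝ) + k) ≤ 2 * a := by
        rw [div_mul_eq_mul_div, le_div_iff₀ (by positivity)] at h2
        nlinarith
      have h9 := merge_first_ge (a := a) (d := d) (k := k) (by norm_num) h8
      have h10 : (k : ℝ) * Real.log (1 + 2 * d / k) ≤ 2 * d := by
        have := Real.log_le_sub_one_of_pos (show (0 : ℝ) < 1 + 2 * d / k by positivity)
        have := mul_le_mul_of_nonneg_left this hk'.le
        have e : (k : ℝ) * (1 + 2 * d / k - 1) = 2 * d := by field_simp; ring
        linarith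
      have h11 : (2 : ℝ) * d < d * Real.log (1 + 8) := by
        rw [show (1 : ℝ) + 8 = 9 by norm_num]
        nlinarith [two_lt_log_nine]
      exact (hsec.trans h10).trans_lt (h11.trans_le h9)

lemma Opt.last_layer_gt {α : ℝ} (hα : α ∈ Ioo (0 : ℝ) 1)
    (hlt : ∀ x ∈ Icc (0 : ℝ) 1, x ≠ α → rate x < rate α) :
    ∃ δ > (0 : ℝ), ∃ N : ℕ, ∀ (l : List ℕ) (c : ℕ), Opt (l ++ [c]) → N ≤ l.sum + c →
      δ * (l.sum + c : ℕ) ≤ c := by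
  have hH := rate_le hlt
  obtain ⟨δ, hδ, hmerge⟩ := exists_merge (show 0 < α / 4 by linarith [hα.1])
  obtain ⟨ε, hε, hst⟩ := rate_stable hlt (half_pos hα.1)
  obtain ⟨N, hN⟩ := Opt.deficit_le hα (show 0 < ε / 4 by positivity)
  refine ⟨min δ (1 / 4), by positivity, N, fun l c hopt hn => ?_⟩
  by_contra! hlast
  have hp := forall_mem_concat.1 hopt.1
  have hc : (0 : ℝ) < c := by exact_mod_cast hp.2
  have hn0 : (0 : ℝ) < (l.sum + c : ℕ) := by simp only [Nat.cast_add]; positivity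
  have hlast1 : (c : ℝ) < δ * (l.sum + c : ℕ) :=
    hlast.trans_le (mul_le_mul_of_nonneg_right (min_le_left _ _) hn0.le)
  have hlast2 : (c : ℝ) < 1 / 4 * (l.sum + c : ℕ) :=
    hlast.trans_le (mul_le_mul_of_nonneg_right (min_le_right _ _) hn0.le)
  rcases List.eq_nil_or_concat l with rfl | ⟨l0, d, rfl⟩
  · simp at hlast2
    linarith
  · rw [List.concat_eq_append] at *
    have hp0 := forall_mem_concat.1 hp.1
    simp only [List.sum_append, List.sum_singleton] at *
    have hd : (0 : ℝ) < d := by exact_mod_cast hp0.2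
    have ha : (0 : ℝ) ≤ l0.sum := Nat.cast_nonneg _
    simp only [Nat.cast_add] at hlast1 hlast2
    rcases le_or_gt (α / 4 * (l0.sum + d + c)) l0.sum with h | h
    · have h1 := hmerge l0.sum d c hp0.2 hp.2 h hlast1.le
      have h2 := hopt.2 (l0 ++ [d + c]) (forall_mem_concat.2 ⟨hp0.1, by omega⟩)
        (by simp)
      have h3 := Real.log_le_log (Ups_pos _) h2
      rw [log_Ups_concat, log_Ups_concat, log_Ups_concat, List.sum_append,
        List.sum_singleton] at h3
      linarith
    · have h1 := hN _ hopt (by simpa [add_assoc] using hn)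
      have h2 := deficit_le_concat hH (l0 ++ [d]) hp.2
      have h3 := deficit_concat (rate α) l0 hp0.2
      have h4 := deficit_nonneg hH l0 hp0.1
      have h5 := hst _ (ratio_mem l0.sum d) (by
        have : (l0.sum : ℝ) / (l0.sum + d : ℕ) ≤ α / 2 := by
          rw [div_le_iff₀ (by simp only [Nat.cast_add]; positivity)]
          simp only [Nat.cast_add]
          nlinarith [hα.1]
        rw [le_abs]; right; linarith)
      simp only [List.sum_append, List.sum_singleton] at h1
      simp only [Nat.cast_add] at h1 h3 h5
      have h6 : (l0.sum : ℝ) ≤ 1 / 4 * (l0.sum + d + c) := by nlinarith [hα.2]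
      have h7 : 1 / 2 * ((l0.sum : ℝ) + d + c) ^ 2 ≤
          ((l0.sum : ℝ) + d) ^ 2 - (l0.sum : ℝ) ^ 2 := by nlinarith
      have h8 := mul_le_mul h7 (show ε ≤ rate α - rate (l0.sum / (l0.sum + d)) by linarith)
        hε.le (le_trans (by positivity) h7)
      have h9 : 0 < ε * ((l0.sum : ℝ) + d + c) ^ 2 := by positivity
      linarith

lemma Opt.ratio_near {α : ℝ} (hα : α ∈ Ioo (0 : ℝ) 1)
    (hlt : ∀ x ∈ Icc (0 : ℝ) 1, x ≠ α → rate x < rate α) {η : ℝ} (hη : 0 < η) :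
    ∃ N : ℕ, ∀ (l : List ℕ) (c : ℕ), Opt (l ++ [c]) → N ≤ l.sum + c →
      |(l.sum : ℝ) / (l.sum + c : ℕ) - α| < η := by
  have hH := rate_le hlt
  obtain ⟨δ, hδ, N₁, hN₁⟩ := Opt.last_layer_gt hα hlt
  obtain ⟨ε, hε, hst⟩ := rate_stable hlt hη
  obtain ⟨N₂, hN₂⟩ := Opt.deficit_le hα (show 0 < δ * ε / 2 by positivity)
  refine ⟨max N₁ N₂, fun l c hopt hn => ?_⟩
  by_contra! hfar
  have hp := forall_mem_concat.1 hopt.1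
  have h1 := hN₁ l c hopt ((le_max_left _ _).trans hn)
  have h2 := hN₂ _ hopt (by simpa using (le_max_right _ _).trans hn)
  have h3 := deficit_concat (rate α) l hp.2
  have h4 := deficit_nonneg hH l hp.1
  have h5 := hst _ (ratio_mem l.sum c) hfar
  simp only [List.sum_append, List.sum_singleton] at h2
  have hc : (0 : ℝ) < c := by exact_mod_cast hp.2
  have ha : (0 : ℝ) ≤ l.sum := Nat.cast_nonneg _
  have hn0 : (0 : ℝ) < (l.sum + c : ℕ) := by simp only [Nat.cast_add]; positivity
  have h7 : δ * ((l.sum + c : ℕ) : ℝ) ^ 2 ≤ ((l.sum + c : ℕ) : ℝ) ^ 2 - (l.sum : ℝ) ^ 2 := by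
    have := mul_le_mul_of_nonneg_right h1 hn0.le
    simp only [Nat.cast_add] at this ⊢
    nlinarith
  have h8 := mul_le_mul h7 (show ε ≤ rate α - rate (l.sum / (l.sum + c : ℕ)) by linarith)
    hε.le (le_trans (by positivity) h7)
  have h9 : 0 < δ * ε * ((l.sum + c : ℕ) : ℝ) ^ 2 := by positivity
  linarith

lemma Opt.tendsto_ratio {α : ℝ} (hα : α ∈ Ioo (0 : ℝ) 1)
    (hlt : ∀ x ∈ Icc (0 : ℝ) 1, x ≠ α → rate x < rate α) {b : ℕ → List ℕ}
    (hb : Tendsto (fun n => (b n).sum) atTop atTop) (hopt : ∀ n, Opt (b n)) :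
    Tendsto (fun n => ((b n).dropLast.sum : ℝ) / (b n).sum) atTop (𝓝 α) := by
  rw [Metric.tendsto_atTop']
  intro η hη
  obtain ⟨N, hN⟩ := Opt.ratio_near hα hlt hη
  obtain ⟨M, hM⟩ := eventually_atTop.1 (hb.eventually_ge_atTop (max N 1))
  refine ⟨M, fun n hn => ?_⟩
  have h1 := hM n hn.le
  rcases List.eq_nil_or_concat (b n) with h | ⟨l, c, h⟩
  · rw [h] at h1; simp at h1
  · have ho := hopt n
    rw [h, List.concat_eq_append] at ho h1 ⊢
    rw [List.sum_append, List.sum_singleton] at h1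
    rw [List.dropLast_concat, List.sum_append, List.sum_singleton]
    exact hN l c ho ((le_max_left _ _).trans h1)

lemma Opt.tendsto_layer {α : ℝ} (hα : α ∈ Ioo (0 : ℝ) 1)
    (hlt : ∀ x ∈ Icc (0 : ℝ) 1, x ≠ α → rate x < rate α) (i : ℕ) :
    ∀ b : ℕ → List ℕ, Tendsto (fun n => (b n).sum) atTop atTop → (∀ n, Opt (b n)) →
      Tendsto (fun n => (((b n).reverse.getD i 0 : ℕ) : ℝ) / (b n).sum) atTop
        (𝓝 ((1 - α) * α ^ i)) := by
  induction i with
  | zero =>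
    intro b hb hopt
    have h := (Opt.tendsto_ratio hα hlt hb hopt).const_sub 1
    rw [pow_zero, mul_one]
    refine h.congr' ?_
    filter_upwards [hb.eventually_ge_atTop 1] with n hn
    have hn' : ((b n).sum : ℝ) ≠ 0 := by positivity
    rcases List.eq_nil_or_concat (b n) with h | ⟨l, c, h⟩
    · rw [h] at hn; simp at hn
    · rw [one_sub_div hn', h, List.concat_eq_append]
      simp
  | succ i ih =>
    intro b hb hopt
    have h := Opt.tendsto_ratio hα hlt hb hopt
    have hb' : Tendsto (fun n => (b n).dropLast.sum) atTop atTop := by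
      rw [← tendsto_natCast_atTop_iff (R := ℝ)]
      refine ((tendsto_natCast_atTop_atTop.comp hb).atTop_mul_pos hα.1 h).congr' ?_
      filter_upwards [hb.eventually_ge_atTop 1] with n hn
      have hn' : ((b n).sum : ℝ) ≠ 0 := by positivity
      simp only [Function.comp]
      field_simp
    have hopt' : ∀ n, Opt (b n).dropLast := fun n => by
      rcases List.eq_nil_or_concat (b n) with h | ⟨l, c, h⟩
      · have := hopt n
        rw [h] at this ⊢
        exact this
      · have := hopt n
        rw [h, List.concat_eq_append] at *
        rw [List.dropLast_concat]
        exact this.init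
    have h2 := (ih _ hb' hopt').mul h
    rw [mul_assoc, ← pow_succ] at h2
    refine h2.congr' ?_
    filter_upwards [hb.eventually_ge_atTop 1, hb'.eventually_ge_atTop 1] with n hn hn1
    have hn1' : ((b n).dropLast.sum : ℝ) ≠ 0 := by positivity
    rw [div_mul_div_cancel₀ hn1']
    rcases List.eq_nil_or_concat (b n) with h | ⟨l, c, h⟩
    · rw [h] at hn; simp at hn
    · rw [h, List.concat_eq_append]
      simp

lemma Opt.of_eq_v {H : ℝ} (hH : ∀ x ∈ Icc (0 : ℝ) 1, rate x ≤ H) {l : List ℕ}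
    (hl : ∀ c ∈ l, 0 < c) (h : Ups l = v l.sum) : Opt l := by
  refine ⟨hl, fun l' hl' hs => ?_⟩
  rw [h, v]
  refine le_csSup ⟨Real.exp (H * (l.sum : ℝ) ^ 2 + 3 * l.sum * (1 + Real.log l.sum)), ?_⟩
    ⟨layeredPerm l', ⟨l', hl', hs, rfl⟩, by rw [Ups, hs]⟩
  rintro _ ⟨_, ⟨m, hm, hms, rfl⟩, rfl⟩
  have h1 := deficit_nonneg hH m hm
  rw [deficit, sub_nonneg, Real.log_le_iff_le_exp (Ups_pos m), Ups, hms] at h1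
  exact h1

end LimitShape

/-- If for each `n` the composition `b n = [b_k, …, b_2, b_1]` (blocks left to right,
so `b_1` is the last layer) gives a layered permutation attaining `v(n)`, then for every
fixed `i ≥ 1` one has `b_i/n → (1−α)·α^{i−1}`, where `α` is the unique solution in `(0,1)`
of `2x·f(x) + (1−x²)·f′(x) = 0`. -/
theorem limit_shape_layers (α : ℝ) (hα : α ∈ Set.Ioo (0 : ℝ) 1)
    (hroot : 2 * α * f α + (1 - α ^ 2) * deriv f α = 0)
    (huniq : ∀ β ∈ Set.Ioo (0 : ℝ) 1,
      2 * β * f β + (1 - β ^ 2) * deriv f β = 0 → β = α)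
    (b : ℕ → List ℕ)
    (hpos : ∀ n, ∀ c ∈ b n, 0 < c)
    (hsum : ∀ n, (b n).sum = n)
    (hmax : ∀ n, ((Upsilon n (layeredPerm (b n)) : ℚ) : ℝ) = v n)
    (i : ℕ) (hi : 1 ≤ i) :
    Filter.Tendsto (fun n : ℕ => (((b n).reverse.getD (i - 1) 0 : ℕ) : ℝ) / n)
      Filter.atTop (nhds ((1 - α) * α ^ (i - 1))) := by
  have hlt := LimitShape.rate_lt_of_ne huniq
  have hH := LimitShape.rate_le hlt
  have h := LimitShape.Opt.tendsto_layer hα hlt (i - 1) b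
    (by simp only [hsum]; exact Filter.tendsto_id)
    fun n => LimitShape.Opt.of_eq_v hH (hpos n) (by rw [LimitShape.Ups, hsum, hmax])
  simpa only [hsum] using h
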